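/- arXiv:2401.07546 — 3 statements merged into one kernel-verified Lean document; each statement's English description precedes it below -/
import Mathlib

section
/- Let U ⊆ ℝ^N be a connected open set and let X_1, …, X_p be C^∞ vector fields on U. Suppose there exists μ ≥ 1 such that for every x ∈ U the linear span of the values at x of all nested Lie brackets X_{(i_1,…,i_r)} with 1 ≤ r ≤ μ and 1 ≤ i_1, …, i_r ≤ p equals all of ℝ^N (the bracket-generating condition). Then any two points x, x′ ∈ U can be joined by a D-path in U, where D_y = span{X_1(y), …, X_p(y)}. -/
noncomputable section
open Set

variable {E : Type*} [NormedAddCommGroup E] [NormedSpace ℝ E]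

/-- Lie bracket of vector fields on a real normed space:
`[X,Y](x) = DY(x)·X(x) − DX(x)·Y(x)`. -/
def lieBracket (X Y : E → E) : E → E := fun x => fderiv ℝ Y x (X x) - fderiv ℝ X x (Y x)

/-- Nested Lie bracket `X_{(i₁,…,i_r)} = [X_{i₁}, [X_{i₂}, …, [X_{i_{r−1}}, X_{i_r}]…]]`,
indexed by a list of indices. -/
def nestedBracket {p : ℕ} (X : Fin p → E → E) : List (Fin p) → E → E
  | [] => fun _ => 0
  | [i] => X i
  | i :: j :: l => lieBracket (X i) (nestedBracket X (j :: l))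

/-- A single C¹ regular arc contained in `U`, with nowhere-vanishing derivative tangent
at every point to the distribution `D`, joining `a` to `b`. -/
def IsDArc (U : Set E) (D : E → Submodule ℝ E) (a b : E) : Prop :=
  ∃ γ γ' : ℝ → E,
    γ 0 = a ∧ γ 1 = b ∧ (∀ t ∈ Icc (0:ℝ) 1, γ t ∈ U) ∧
    ContinuousOn γ' (Icc (0:ℝ) 1) ∧
    ∀ t ∈ Icc (0:ℝ) 1, HasDerivWithinAt γ (γ' t) (Icc (0:ℝ) 1) t ∧ γ' t ≠ 0 ∧ γ' t ∈ D (γ t)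

/-- Two points are joined by a D-path iff they are related by the reflexive-transitive
closure of the relation "joined by a single D-arc" (finite concatenation of arcs). -/
def DJoined (U : Set E) (D : E → Submodule ℝ E) : E → E → Prop :=
  Relation.ReflTransGen (IsDArc U D)

section Helpers
open Filter Topology

section CompOp
variable {K : Type} [TopologicalSpace K] [CompactSpace K]
variable {E : Type} [NormedAddCommGroup E] [NormedSpace ℝ E]
variable {F : Type} [NormedAddCommGroup F] [NormedSpace ℝ F]

def applyMap : C(K, E →L[ℝ] F) →L[ℝ] (C(K, E) →L[ℝ] C(K, F)) :=
  LinearMap.mkContinuous₂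
    (LinearMap.mk₂ ℝ (fun (A : C(K, E →L[ℝ] F)) (h : C(K, E)) =>
        (⟨fun k => A k (h k), by fun_prop⟩ : C(K, F)))
      (by intros; ext; simp) (by intros; ext; simp) (by intros; ext; simp) (by intros; ext; simp))
    1 (by
      intro A h
      rw [ContinuousMap.norm_le _ (by positivity)]
      intro k
      simp only [LinearMap.mk₂_apply, ContinuousMap.coe_mk, one_mul]
      exact (ContinuousLinearMap.le_opNorm _ _).trans
        (mul_le_mul (A.norm_coe_le_norm k) (h.norm_coe_le_norm k) (norm_nonneg _) (by positivity)))

lemma applyMap_apply (A : C(K, E →L[ℝ] F)) (h : C(K, E)) (k : K) :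
    applyMap A h k = A k (h k) := rfl

def compOp (G : C(E, F)) : C(K, E) → C(K, F) := fun γ => G.comp γ

lemma compOp_hasFDerivAt (G : C(E, F)) (G' : C(E, E →L[ℝ] F)) (hG : ∀ x, HasFDerivAt G (G' x) x)
    (γ : C(K, E)) : HasFDerivAt (compOp (K := K) G) (applyMap (compOp G' γ)) γ := by
  rw [hasFDerivAt_iff_isLittleO, Asymptotics.isLittleO_iff]
  intro c hc
  have hK : IsCompact (range γ) := isCompact_range γ.continuous
  have := hK.uniformContinuousAt_of_continuousAt (r := {p | dist p.1 p.2 < c}) G'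
    (fun a _ => G'.continuous.continuousAt) (Metric.dist_mem_uniformity hc)
  obtain ⟨δ, hδ, hh⟩ := Metric.mem_uniformity_dist.1 this
  filter_upwards [Metric.ball_mem_nhds γ hδ] with η hη
  rw [ContinuousMap.norm_le _ (by positivity)]
  intro k
  have hk : dist (η k) (γ k) < δ := (ContinuousMap.dist_apply_le_dist k).trans_lt hη
  have := (convex_ball (γ k) δ).norm_image_sub_le_of_norm_hasFDerivWithin_le' (f := G)
    (f' := G') (φ := G' (γ k)) (C := c) (x := γ k) (y := η k)
    (fun x _ => (hG x).hasFDerivWithinAt)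
    (by
      intro x hx
      have := hh (a := γ k) (b := x) (by rw [dist_comm]; exact hx) (mem_range_self k)
      rw [← dist_eq_norm, dist_comm]
      exact this.le)
    (Metric.mem_ball_self hδ) hk
  refine this.trans ?_
  gcongr
  exact (η - γ).norm_coe_le_norm k
end CompOp

lemma compOp_contDiff {K : Type} [TopologicalSpace K] [CompactSpace K]
    {E : Type} [NormedAddCommGroup E] [NormedSpace ℝ E] (n : ℕ) :
    ∀ {F : Type} [NormedAddCommGroup F] [NormedSpace ℝ F] (G : C(E, F)), ContDiff ℝ n G →
    ContDiff ℝ n (compOp (K := K) G) := by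
  induction n with
  | zero =>
    intro F _ _ G hG
    rw [Nat.cast_zero, contDiff_zero]
    exact ContinuousMap.continuous_postcomp G
  | succ n ih =>
    intro F _ _ G hG
    have h2 : ContDiff ℝ n (fderiv ℝ G) := hG.fderiv_right (by norm_cast)
    have h3 := ih ⟨fderiv ℝ G, h2.continuous⟩ h2
    refine (contDiff_succ_iff_hasFDerivAt (n := n)).2 ⟨fun γ => applyMap (compOp ⟨fderiv ℝ G, h2.continuous⟩ γ), 
      ContDiff.comp (g := applyMap) (ContinuousLinearMap.contDiff _) h3, fun γ => compOp_hasFDerivAt G _ (fun x => ?_) γ⟩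
    exact (hG.differentiable (by simp) x).hasFDerivAt

section J
open unitInterval MeasureTheory
variable {E : Type} [NormedAddCommGroup E] [NormedSpace ℝ E] 

def ext01 (g : C(I, E)) : ℝ → E := fun s => g (projIcc 0 1 zero_le_one s)

lemma ext01_cont (g : C(I, E)) : Continuous (ext01 g) := by
  unfold ext01; fun_prop

def integ : C(I, E) →L[ℝ] C(I, E) :=
  LinearMap.mkContinuous
    { toFun := fun g => ⟨fun u => ∫ s in (0:ℝ)..u, ext01 g s, by
        exact (intervalIntegral.continuous_primitive
          (fun a b => (ext01_cont g).intervalIntegrable a b) 0).comp continuous_subtype_val⟩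
      map_add' := by
        intro f g; ext u
        simp only [ContinuousMap.coe_mk, ContinuousMap.add_apply]
        rw [← intervalIntegral.integral_add ((ext01_cont f).intervalIntegrable _ _)
          ((ext01_cont g).intervalIntegrable _ _)]
        rfl
      map_smul' := by
        intro c g; ext u
        simp only [ContinuousMap.coe_mk, ContinuousMap.smul_apply, RingHom.id_apply]
        rw [← intervalIntegral.integral_smul]
        rfl }
    1 (by
      intro g
      rw [ContinuousMap.norm_le _ (by positivity)]
      intro u
      have := intervalIntegral.norm_integral_le_of_norm_le_const (a := 0) (b := (u:ℝ)) (f := ext01 g)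
        (C := ‖g‖) (fun x _ => g.norm_coe_le_norm _)
      refine this.trans ?_
      have h1 := u.2.1
      have h2 := u.2.2
      rw [sub_zero, abs_of_nonneg h1, one_mul]
      exact mul_le_of_le_one_right (norm_nonneg _) h2)

lemma integ_apply (g : C(I, E)) (u : I) : integ g u = ∫ s in (0:ℝ)..u, ext01 g s := rfl
end J

section Flow
open unitInterval
variable {E : Type} [NormedAddCommGroup E] [NormedSpace ℝ E]

def constC : E →L[ℝ] C(I, E) :=
  LinearMap.mkContinuous
    { toFun := fun x => ContinuousMap.const I x
      map_add' := by intros; ext; simp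
      map_smul' := by intros; ext; simp } 1
    (by
      intro x
      rw [ContinuousMap.norm_le _ (by positivity)]
      intro u
      simp)

lemma constC_apply (x : E) (u : I) : constC x u = x := rfl

lemma exists_flow_curves [CompleteSpace E] (G : C(E, E)) (hG : ContDiff ℝ 2 G) (x0 : E) :
    ∃ Γ : ℝ × E → C(I, E), ContDiffAt ℝ 2 Γ (0, x0) ∧ Γ (0, x0) = constC x0 ∧
      ∀ᶠ p in 𝓝 ((0 : ℝ), x0), Γ p = constC p.2 + p.1 • integ (compOp G (Γ p)) := by
  let f : (ℝ × E) × C(I, E) → C(I, E) := fun q =>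
    q.2 - constC q.1.2 - q.1.1 • integ (compOp G q.2)
  let u : (ℝ × E) × C(I, E) := ((0, x0), constC x0)
  have hc : ContDiff ℝ 2 (compOp (K := I) G) := compOp_contDiff 2 G hG
  have cdf : ContDiff ℝ 2 f := by
    have h1 : ContDiff ℝ 2 (fun q : (ℝ × E) × C(I, E) => integ (compOp G q.2)) :=
      (ContinuousLinearMap.contDiff _).comp (hc.comp contDiff_snd)
    have h2 : ContDiff ℝ 2 (fun q : (ℝ × E) × C(I, E) => constC q.1.2) :=
      (ContinuousLinearMap.contDiff _).comp (contDiff_snd.comp contDiff_fst)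
    exact (contDiff_snd.sub h2).sub ((contDiff_fst.comp contDiff_fst).smul h1)
  have hu : f u = 0 := by simp [f, u]
  have if2 : fderiv ℝ f u ∘L .inr ℝ (ℝ × E) C(I, E) = ContinuousLinearMap.id ℝ _ := by
    have h1 : HasFDerivAt f (fderiv ℝ f u) u :=
      (cdf.differentiable (by simp) u).hasFDerivAt
    have h2 : HasFDerivAt (fun y : C(I, E) => (((0:ℝ), x0), y))
      (ContinuousLinearMap.inr ℝ (ℝ × E) C(I, E)) (constC x0) := hasFDerivAt_prodMk_right _ _
    have h3 := HasFDerivAt.comp (constC x0) (g := f) h1 h2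
    have h4 : f ∘ (fun y : C(I, E) => (((0:ℝ), x0), y)) = fun y => y - constC x0 := by
      ext1 y; simp [f]
    rw [h4] at h3
    exact h3.unique ((hasFDerivAt_id _).sub_const _)
  have if2' : (fderiv ℝ f u ∘L .inr ℝ (ℝ × E) C(I, E)).IsInvertible := by
    rw [if2]; exact ContinuousLinearMap.isInvertible_equiv (f := ContinuousLinearEquiv.refl ℝ _)
  have cdf' : ContDiffAt ℝ 2 f u := cdf.contDiffAt
  refine ⟨cdf'.implicitFunction (by simp) if2', cdf'.contDiffAt_implicitFunction _ _,
    cdf'.implicitFunction_apply_self _ _, ?_⟩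
  filter_upwards [cdf'.eventually_apply_implicitFunction (by simp) if2'] with p hp
  exact sub_eq_zero.1 ((sub_sub _ _ _).symm.trans (hp.trans hu))

lemma exists_cutoff [FiniteDimensional ℝ E] {U : Set E} (hU : IsOpen U) {X : E → E}
    (hX : ContDiffOn ℝ (⊤ : ℕ∞) X U) {x0 : E} (hx : x0 ∈ U) :
    ∃ G : C(E, E), ContDiff ℝ 2 G ∧ (∃ K, LipschitzWith K G) ∧ ∀ᶠ x in 𝓝 x0, G x = X x := by
  obtain ⟨r, hr, hrU⟩ := Metric.isOpen_iff.1 hU x0 hx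
  let f : ContDiffBump x0 := ⟨r/3, r/2, by positivity, by linarith⟩
  have hG : ContDiff ℝ 2 (fun x => f x • X x) := by
    rw [contDiff_iff_contDiffAt]
    intro x
    by_cases hxU : x ∈ U
    · exact f.contDiffAt.smul (((hX.contDiffAt (hU.mem_nhds hxU))).of_le (by exact_mod_cast le_top))
    · have : x ∉ tsupport f := by
        rw [f.tsupport_eq]
        intro h
        apply hxU
        apply hrU
        rw [Metric.mem_closedBall] at h
        rw [Metric.mem_ball]
        have : f.rOut = r/2 := rfl
        linarith
      have h0 : (fun x => f x • X x) =ᶠ[𝓝 x] fun _ => 0 := by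
        filter_upwards [notMem_tsupport_iff_eventuallyEq.1 this] with y hy
        simp [hy]
      exact contDiffAt_const.congr_of_eventuallyEq h0
  refine ⟨⟨_, hG.continuous⟩, hG, ?_, ?_⟩
  · exact ContDiff.lipschitzWith_of_hasCompactSupport (𝕂 := ℝ) (f.hasCompactSupport.smul_right) hG (by simp)
  · filter_upwards [f.eventuallyEq_one] with y hy
    simp [hy]

lemma arc_of_curve {U : Set E} [CompleteSpace E] {D : E → Submodule ℝ E} (G : C(E, E)) {K} (hK : LipschitzWith K G)
    (V : Set E) (hVU : V ⊆ U) (hV : ∀ x ∈ V, G x ∈ D x) (t : ℝ) (x : E) (γ : C(I, E))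
    (hγ : γ = constC x + t • integ (compOp G γ)) (hγV : ∀ u, γ u ∈ V) :
    DJoined U D x (γ 1) := by
  let c : ℝ → E := fun u => x + t • ∫ s in (0:ℝ)..u, ext01 (compOp G γ) s
  have hc : ∀ u : I, c u = γ u := by
    intro u
    conv_rhs => rw [hγ]
    simp [c, constC_apply, integ_apply]
  have hd : ∀ u ∈ Icc (0:ℝ) 1, HasDerivAt c (t • G (c u)) u := by
    intro u hu
    have h1 := intervalIntegral.integral_hasDerivAt_right
      ((ext01_cont (compOp G γ)).intervalIntegrable 0 u)
      ((ext01_cont (compOp G γ)).stronglyMeasurableAtFilter _ _)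
      (ext01_cont (compOp G γ)).continuousAt
    have h2 := (h1.const_smul t).const_add x
    have h3 : ext01 (compOp G γ) u = G (c u) := by
      simp only [ext01, projIcc_of_mem _ hu]
      rw [hc ⟨u, hu⟩]; rfl
    rw [h3] at h2
    exact h2
  have hc0 : c 0 = x := by simp [c]
  have hc1 : c 1 = γ 1 := hc 1
  have hcont : ContinuousOn c (Icc 0 1) := fun u hu => (hd u hu).continuousAt.continuousWithinAt
  by_cases hz : ∃ u0 ∈ Icc (0:ℝ) 1, t • G (c u0) = 0
  · obtain ⟨u0, hu0, h0⟩ := hz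
    have hL : ∀ s : ℝ, LipschitzOnWith (‖t‖₊ * K) (fun y => t • G y) univ := fun s =>
      ((lipschitzWith_smul t).comp hK).lipschitzOnWith
    have e1 : EqOn c (fun _ => c u0) (Icc u0 1) :=
      ODE_solution_unique_of_mem_Icc_right (v := fun _ y => t • G y) (s := fun _ => univ)
        (fun s _ => hL s) (hcont.mono (Icc_subset_Icc_left hu0.1))
        (fun s hs => (hd s ⟨hu0.1.trans hs.1, hs.2.le⟩).hasDerivWithinAt) (fun _ _ => mem_univ _)
        continuousOn_const (fun s hs => by simpa [h0] using hasDerivWithinAt_const s (Ici s) (c u0)) (fun _ _ => mem_univ _) rfl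
    have e2 : EqOn c (fun _ => c u0) (Icc 0 u0) :=
      ODE_solution_unique_of_mem_Icc_left (v := fun _ y => t • G y) (s := fun _ => univ)
        (fun s _ => hL s) (hcont.mono (Icc_subset_Icc_right hu0.2))
        (fun s hs => (hd s ⟨hs.1.le, hs.2.trans hu0.2⟩).hasDerivWithinAt) (fun _ _ => mem_univ _)
        continuousOn_const (fun s hs => by simpa [h0] using hasDerivWithinAt_const s (Iic s) (c u0)) (fun _ _ => mem_univ _) rfl
    have : x = γ 1 := by
      rw [← hc0, ← hc1, e1 ⟨hu0.2, le_rfl⟩, e2 ⟨le_rfl, hu0.1⟩]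
    rw [← this]
    exact Relation.ReflTransGen.refl
  · push Not at hz
    refine Relation.ReflTransGen.single ⟨c, fun u => t • G (c u), hc0, hc1, ?_, ?_, ?_⟩
    · intro u hu
      exact hVU (hc ⟨u, hu⟩ ▸ hγV _)
    · exact (G.continuous.comp_continuousOn hcont).const_smul t
    · intro u hu
      refine ⟨(hd u hu).hasDerivWithinAt, hz u hu, Submodule.smul_mem _ _ (hV _ ?_)⟩
      exact (hc ⟨u, hu⟩ ▸ hγV _)

lemma exists_flow [FiniteDimensional ℝ E] {U : Set E} (hU : IsOpen U) {X : E → E}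
    (hX : ContDiffOn ℝ (⊤ : ℕ∞) X U) {D : E → Submodule ℝ E} (hD : ∀ x, X x ∈ D x)
    {x0 : E} (hx : x0 ∈ U) :
    ∃ Φ : ℝ × E → E, ContDiffAt ℝ 2 Φ (0, x0) ∧
      (∀ᶠ p in 𝓝 ((0:ℝ), x0), DJoined U D p.2 (Φ p)) ∧
      (∀ᶠ x in 𝓝 x0, Φ (0, x) = x) ∧
      HasDerivAt (fun t => Φ (t, x0)) (X x0) 0 := by
  have : CompleteSpace E := FiniteDimensional.complete ℝ E
  obtain ⟨G, hG, ⟨K, hK⟩, hGX⟩ := exists_cutoff hU hX hx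
  obtain ⟨Γ, hΓ, hΓ0, hΓe⟩ := exists_flow_curves G hG x0
  obtain ⟨r, hr, hrV⟩ := Metric.eventually_nhds_iff_ball.1 (hGX.and (hU.mem_nhds hx))
  refine ⟨fun p => Γ p 1, ?_, ?_, ?_, ?_⟩
  · exact (ContinuousMap.evalCLM ℝ (1 : I) : C(I, E) →L[ℝ] E).contDiff.contDiffAt.comp _ hΓ
  · have hcl := hΓ.continuousAt.eventually (Metric.ball_mem_nhds (Γ (0, x0)) hr)
    filter_upwards [hΓe, hcl] with p hp hpb
    refine arc_of_curve G hK (Metric.ball x0 r) (fun y hy => (hrV y hy).2) 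
      (fun y hy => by rw [(hrV y hy).1]; exact hD y) p.1 p.2 (Γ p) hp ?_
    intro u
    have := (ContinuousMap.dist_apply_le_dist (f := Γ p) (g := Γ (0, x0)) u).trans_lt hpb
    rw [hΓ0, constC_apply] at this
    exact this
  · have : Tendsto (fun x : E => ((0:ℝ), x)) (𝓝 x0) (𝓝 (0, x0)) := by
      have : Continuous (fun x : E => ((0:ℝ), x)) := by fun_prop
      exact this.tendsto x0
    filter_upwards [this.eventually hΓe] with x hx
    rw [hx]; simp [constC_apply]
  · have ht : Tendsto (fun t : ℝ => (t, x0)) (𝓝 0) (𝓝 (0, x0)) := by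
      have : Continuous (fun t : ℝ => (t, x0)) := by fun_prop
      exact this.tendsto 0
    let w : ℝ → E := fun t => integ (compOp G (Γ (t, x0))) 1
    have hw : ContinuousAt w 0 := by
      have h1 : Continuous (fun γ : C(I, E) => (integ (compOp G γ)) (1 : I)) := 
        (ContinuousMap.evalCLM ℝ (1 : I) : C(I, E) →L[ℝ] E).continuous.comp (integ.continuous.comp 
          (ContinuousMap.continuous_postcomp G))
      exact h1.continuousAt.comp (Tendsto.comp hΓ.continuousAt ht)
    have hw0 : w 0 = X x0 := by
      have h2 : ∀ s, ext01 (compOp G (constC x0)) s = X x0 := by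
        intro s; exact hGX.self_of_nhds
      simp only [w, hΓ0, integ_apply, h2]
      simp
    have he : (fun t => Γ (t, x0) 1) =ᶠ[𝓝 0] fun t => x0 + t • w t := by
      filter_upwards [ht.eventually hΓe] with t ht
      conv_lhs => rw [ht]
      simp [constC_apply, w]
    refine HasDerivAt.congr_of_eventuallyEq ?_ he
    rw [← hw0]
    refine HasDerivAt.const_add x0 ?_
    rw [hasDerivAt_iff_tendsto_slope]
    refine (hw.tendsto.mono_left nhdsWithin_le_nhds).congr' ?_
    filter_upwards [self_mem_nhdsWithin] with t ht
    simp [slope, smul_smul, inv_mul_cancel₀ (show t ≠ 0 from ht)]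
end Flow

section Geo
variable {E : Type} [NormedAddCommGroup E] [NormedSpace ℝ E]
variable {S : Type} [NormedAddCommGroup S] [NormedSpace ℝ S]

lemma IsDArc.symm {U : Set E} {D : E → Submodule ℝ E} {a b : E} (h : IsDArc U D a b) :
    IsDArc U D b a := by
  obtain ⟨γ, γ', h0, h1, hU, hc, hd⟩ := h
  have hm : ∀ t ∈ Icc (0:ℝ) 1, 1 - t ∈ Icc (0:ℝ) 1 := fun t ht => ⟨by linarith [ht.2], by linarith [ht.1]⟩
  refine ⟨fun t => γ (1 - t), fun t => - γ' (1 - t), by simpa using h1, by simpa using h0,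
    fun t ht => hU _ (hm t ht), ?_, ?_⟩
  · exact (hc.comp (by fun_prop) hm).neg
  · intro t ht
    obtain ⟨h1, h2, h3⟩ := hd _ (hm t ht)
    refine ⟨?_, neg_ne_zero.2 h2, Submodule.neg_mem _ h3⟩
    have h4 : HasDerivWithinAt (fun t : ℝ => 1 - t) (-1) (Icc (0:ℝ) 1) t := by
      simpa using (hasDerivWithinAt_id t (Icc (0:ℝ) 1)).const_sub 1
    simpa [Function.comp_def] using HasDerivWithinAt.scomp t h1 h4 hm

lemma DJoined.symm {U : Set E} {D : E → Submodule ℝ E} {a b : E} (h : DJoined U D a b) :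
    DJoined U D b a := by
  induction h with
  | refl => exact Relation.ReflTransGen.refl
  | tail _ h ih => exact Relation.ReflTransGen.head h.symm ih

lemma DJoined.mem {U : Set E} {D : E → Submodule ℝ E} {a b : E} (h : DJoined U D a b)
    (ha : a ∈ U) : b ∈ U := by
  induction h with
  | refl => exact ha
  | tail _ h ih =>
    obtain ⟨γ, γ', h0, h1, hU, hc, hd⟩ := h
    rw [← h1]; exact hU 1 (by simp)

lemma tangent_lift [FiniteDimensional ℝ E] [FiniteDimensional ℝ S] {f : S → E} {s0 : S}
    (hf : ContDiffAt ℝ 2 f s0) (hi : Function.Injective (fderiv ℝ f s0)) :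
    (∀ᶠ s in 𝓝 s0, Function.Injective (fderiv ℝ f s)) ∧
    ∀ V : E → E, ContDiffAt ℝ 1 V (f s0) → (∀ᶠ s in 𝓝 s0, V (f s) ∈ range (fderiv ℝ f s)) →
    ∃ v : S → S, ContDiffAt ℝ 1 v s0 ∧ ∀ᶠ s in 𝓝 s0, fderiv ℝ f s (v s) = V (f s) := by
  have : CompleteSpace S := FiniteDimensional.complete ℝ S
  obtain ⟨P0, hP0⟩ := LinearMap.exists_leftInverse_of_injective (fderiv ℝ f s0 : S →ₗ[ℝ] E)
    (LinearMap.ker_eq_bot.2 hi)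
  let P : E →L[ℝ] S := LinearMap.toContinuousLinearMap P0
  let A : S → S →L[ℝ] S := fun s => P ∘L fderiv ℝ f s
  have hA0 : A s0 = 1 := by
    ext s
    exact LinearMap.congr_fun hP0 s
  have hfd : ContDiffAt ℝ 1 (fderiv ℝ f) s0 := hf.fderiv_right (by norm_num)
  have hA : ContDiffAt ℝ 1 A s0 := contDiffAt_const.clm_comp hfd
  have hu : ∀ᶠ s in 𝓝 s0, IsUnit (A s) :=
    hA.continuousAt.eventually (Units.isOpen.mem_nhds (by rw [hA0]; exact isUnit_one))
  have hinv : ∀ s, IsUnit (A s) → ∀ w, Ring.inverse (A s) (P (fderiv ℝ f s w)) = w := by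
    intro s hs w
    have := Ring.inverse_mul_cancel _ hs
    exact ContinuousLinearMap.ext_iff.1 this w
  constructor
  · filter_upwards [hu] with s hs a b hab
    rw [← hinv s hs a, hab, hinv s hs b]
  · intro V hV ht
    refine ⟨fun s => Ring.inverse (A s) (P (V (f s))), ?_, ?_⟩
    · refine ContDiffAt.clm_apply ?_ ?_
      · have := contDiffAt_ringInverse ℝ (n := 1) (1 : (S →L[ℝ] S)ˣ)
        refine ContDiffAt.comp s0 (g := Ring.inverse) ?_ hA
        rw [hA0]; exact this
      · exact P.contDiff.contDiffAt.comp _ (hV.comp _ (hf.of_le (by norm_num)))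
    · filter_upwards [hu, ht] with s hs ⟨w, hw⟩
      rw [← hw, hinv s hs]

lemma bracket_tangent [FiniteDimensional ℝ E] [FiniteDimensional ℝ S] {f : S → E} {s0 : S}
    (hf : ContDiffAt ℝ 2 f s0) (hi : Function.Injective (fderiv ℝ f s0)) {V W : E → E}
    (hV : ContDiffAt ℝ 1 V (f s0)) (hW : ContDiffAt ℝ 1 W (f s0))
    (hV' : ∀ᶠ s in 𝓝 s0, V (f s) ∈ range (fderiv ℝ f s))
    (hW' : ∀ᶠ s in 𝓝 s0, W (f s) ∈ range (fderiv ℝ f s)) :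
    ∀ᶠ s in 𝓝 s0, lieBracket V W (f s) ∈ range (fderiv ℝ f s) := by
  obtain ⟨v, hv, hve⟩ := (tangent_lift hf hi).2 V hV hV'
  obtain ⟨w, hw, hwe⟩ := (tangent_lift hf hi).2 W hW hW'
  have key : ∀ (s : S) (W : E → E) (w v : S → S), ContDiffAt ℝ 2 f s → ContDiffAt ℝ 1 w s →
      ContDiffAt ℝ 1 W (f s) → (∀ᶠ s' in 𝓝 s, fderiv ℝ f s' (w s') = W (f s')) →
      fderiv ℝ W (f s) (fderiv ℝ f s (v s)) =
        fderiv ℝ (fderiv ℝ f) s (v s) (w s) + fderiv ℝ f s (fderiv ℝ w s (v s)) := by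
    intro s W w v hf hw hW he
    have h1 : HasFDerivAt (fun s' => W (f s')) _ s :=
      (hW.differentiableAt (by simp)).hasFDerivAt.comp s (hf.differentiableAt (by simp)).hasFDerivAt
    have h2 : HasFDerivAt (fun s' => fderiv ℝ f s' (w s')) _ s :=
      ((hf.fderiv_right (m := 1) (by norm_num)).differentiableAt (by simp)).hasFDerivAt.clm_apply
        (hw.differentiableAt (by simp)).hasFDerivAt
    have h3 := h1.unique (h2.congr_of_eventuallyEq (EventuallyEq.symm he))
    have h4 := ContinuousLinearMap.ext_iff.1 h3 (v s)
    simp only [ContinuousLinearMap.comp_apply, add_apply,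
      ContinuousLinearMap.flip_apply] at h4
    rw [h4, add_comm]
  filter_upwards [hf.eventually (by simp), hv.eventually (by simp), hw.eventually (by simp),
    hf.continuousAt.eventually (hV.eventually (by simp)),
    hf.continuousAt.eventually (hW.eventually (by simp)),
    hve.eventually_nhds, hwe.eventually_nhds] with s a1 a2 a3 a4 a5 a6 a7
  refine ⟨fderiv ℝ w s (v s) - fderiv ℝ v s (w s), ?_⟩
  have k1 := key s W w v a1 a3 a5 a7
  have k2 := key s V v w a1 a2 a4 a6
  have hs : IsSymmSndFDerivAt ℝ f s := a1.isSymmSndFDerivAt (by simp)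
  have hs' := hs.eq (v s) (w s)
  rw [a6.self_of_nhds] at k1
  rw [a7.self_of_nhds] at k2
  rw [lieBracket, k1, k2, hs', map_sub]
  abel

lemma nestedBracket_contDiffOn {p : ℕ} {U : Set E} (hU : IsOpen U) {X : Fin p → E → E}
    (hX : ∀ i, ContDiffOn ℝ (⊤ : ℕ∞) (X i) U) :
    ∀ l, ContDiffOn ℝ (⊤ : ℕ∞) (nestedBracket X l) U
  | [] => contDiffOn_const
  | [i] => hX i
  | i :: j :: l => by
    have h := nestedBracket_contDiffOn hU hX (j :: l)
    exact ((h.fderiv_of_isOpen hU (by simp)).clm_apply (hX i)).sub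
      (((hX i).fderiv_of_isOpen hU (by simp)).clm_apply h)

lemma nestedBracket_tangent [FiniteDimensional ℝ E] [FiniteDimensional ℝ S]
    {p : ℕ} {U : Set E} (hU : IsOpen U) {X : Fin p → E → E}
    (hX : ∀ i, ContDiffOn ℝ (⊤ : ℕ∞) (X i) U) {f : S → E} {s0 : S} (h0 : f s0 ∈ U)
    (hf : ContDiffAt ℝ 2 f s0) (hi : Function.Injective (fderiv ℝ f s0)) 
    (ht : ∀ i, ∀ᶠ s in 𝓝 s0, X i (f s) ∈ range (fderiv ℝ f s)) :
    ∀ l, ∀ᶠ s in 𝓝 s0, nestedBracket X l (f s) ∈ range (fderiv ℝ f s)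
  | [] => Eventually.of_forall fun s => ⟨0, by simp [nestedBracket]⟩
  | [i] => ht i
  | i :: j :: l => by
    have h1 : ∀ V : E → E, ContDiffOn ℝ (⊤ : ℕ∞) V U → ContDiffAt ℝ 1 V (f s0) := fun V hV =>
      (hV.contDiffAt (hU.mem_nhds h0)).of_le (by exact_mod_cast le_top)
    exact bracket_tangent hf hi (h1 _ (hX i)) (h1 _ (nestedBracket_contDiffOn hU hX _)) (ht i)
      (nestedBracket_tangent hU hX h0 hf hi ht (j :: l))

def Transp (U : Set E) (D : E → Submodule ℝ E) (y z : E) : Prop :=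
  ∃ h : E → E, ContinuousAt h y ∧ h y = z ∧ ∀ᶠ y' in 𝓝 y, DJoined U D y' (h y')

lemma Transp.trans {U : Set E} {D : E → Submodule ℝ E} {x y z : E} (h1 : Transp U D x y)
    (h2 : Transp U D y z) : Transp U D x z := by
  obtain ⟨g, a1, a2, a3⟩ := h1
  obtain ⟨h, b1, b2, b3⟩ := h2
  subst a2
  refine ⟨h ∘ g, b1.comp a1, b2, ?_⟩
  filter_upwards [a3, a1.eventually b3] with x' c1 c2
  exact Relation.ReflTransGen.trans c1 c2

lemma Transp.djoined {U : Set E} {D : E → Submodule ℝ E} {x y : E} (h1 : Transp U D x y) :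
    DJoined U D x y := by
  obtain ⟨g, a1, a2, a3⟩ := h1
  rw [← a2]
  exact a3.self_of_nhds

lemma krener [FiniteDimensional ℝ E] {p : ℕ} {U : Set E} (hU : IsOpen U) {X : Fin p → E → E}
    (hX : ∀ i, ContDiffOn ℝ (⊤ : ℕ∞) (X i) U) {D : E → Submodule ℝ E} (hD : ∀ i x, X i x ∈ D x)
    (hspan : ∀ x ∈ U, Submodule.span ℝ {v | ∃ l : List (Fin p), v = nestedBracket X l x} = ⊤)
    {x0 : E} (hx0 : x0 ∈ U) (k : ℕ) (hk : k ≤ Module.finrank ℝ E) :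
    ∃ (S : Type) (_ : NormedAddCommGroup S) (_ : NormedSpace ℝ S) (_ : FiniteDimensional ℝ S)
      (f : S → E) (s0 : S), Module.finrank ℝ S = k ∧ ContDiffAt ℝ 2 f s0 ∧
        Function.Injective (fderiv ℝ f s0) ∧ ∀ᶠ s in 𝓝 s0, Transp U D x0 (f s) := by
  induction k with
  | zero =>
    refine ⟨EuclideanSpace ℝ (Fin 0), inferInstance, inferInstance, inferInstance, fun _ => x0, 0,
      by simp, contDiffAt_const, Function.injective_of_subsingleton _, Eventually.of_forall fun s => 
      ⟨id, continuousAt_id, rfl, Eventually.of_forall fun _ => Relation.ReflTransGen.refl⟩⟩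
  | succ k ih =>
    obtain ⟨S, _, _, _, f, s0, hS, hf, hi, hT⟩ := ih (by omega)
    have h1 : ∃ i, ∃ᶠ s in 𝓝 s0, X i (f s) ∉ range (fderiv ℝ f s) := by
      by_contra! hcon
      have h0 : f s0 ∈ U := hT.self_of_nhds.djoined.mem hx0
      have hl := nestedBracket_tangent hU hX h0 hf hi hcon
      have htop : (⊤ : Submodule ℝ E) ≤ LinearMap.range (fderiv ℝ f s0 : S →ₗ[ℝ] E) := by
        rw [← hspan _ h0, Submodule.span_le]
        rintro v ⟨l, rfl⟩
        exact (hl l).self_of_nhds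
      have h2 := LinearMap.finrank_range_le (fderiv ℝ f s0 : S →ₗ[ℝ] E)
      rw [top_le_iff.1 htop, finrank_top] at h2
      omega
    obtain ⟨i, hfr⟩ := h1
    obtain ⟨s1, hs1, hT1, hf1, hi1⟩ := (hfr.and_eventually (hT.eventually_nhds.and
      ((hf.eventually (by simp)).and (tangent_lift hf hi).1))).exists
    have hU1 : f s1 ∈ U := hT1.self_of_nhds.djoined.mem hx0
    obtain ⟨Φ, hΦ, hΦj, hΦ0, hΦd⟩ := exists_flow hU (hX i) (hD i) hU1
    let m : S × ℝ → ℝ × E := fun q => (q.2, f q.1)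
    have hm : ContDiffAt ℝ 2 m (s1, 0) :=
      contDiffAt_snd.prodMk (ContDiffAt.comp (s1, (0:ℝ)) (g := f) hf1 contDiffAt_fst)
    refine ⟨S × ℝ, inferInstance, inferInstance, inferInstance, fun q => Φ (m q), (s1, 0), ?_, ?_, ?_, ?_⟩
    · simp [hS]
    · exact ContDiffAt.comp _ (g := Φ) hΦ hm
    · have hL : HasFDerivAt Φ (fderiv ℝ Φ (0, f s1)) (0, f s1) :=
        (hΦ.differentiableAt (by simp)).hasFDerivAt
      have hfd := (hf1.differentiableAt (by simp)).hasFDerivAt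
      have hL1 : fderiv ℝ Φ (0, f s1) (1, 0) = X i (f s1) := by
        have a1 : HasDerivAt (fun t : ℝ => (t, f s1)) ((1:ℝ), (0:E)) 0 :=
          (hasDerivAt_id (0:ℝ)).prodMk (hasDerivAt_const _ _)
        have a2 := HasFDerivAt.comp_hasDerivAt (0:ℝ) (l := Φ) hL a1
        exact a2.unique hΦd
      have hL2 : ∀ y, fderiv ℝ Φ (0, f s1) (0, y) = y := by
        intro y
        have a1 : HasFDerivAt (fun x : E => ((0:ℝ), x)) (ContinuousLinearMap.inr ℝ ℝ E) (f s1) :=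
          hasFDerivAt_prodMk_right _ _
        have a2 := HasFDerivAt.comp (f s1) (g := Φ) hL a1
        have a3 := a2.unique ((hasFDerivAt_id (f s1)).congr_of_eventuallyEq hΦ0)
        exact ContinuousLinearMap.ext_iff.1 a3 y
      have hmd : HasFDerivAt m ((ContinuousLinearMap.snd ℝ S ℝ).prod
          (fderiv ℝ f s1 ∘L ContinuousLinearMap.fst ℝ S ℝ)) (s1, 0) :=
        hasFDerivAt_snd.prodMk (HasFDerivAt.comp (s1, (0:ℝ)) (g := f) hfd hasFDerivAt_fst)
      have hcomp : HasFDerivAt (fun q => Φ (m q)) _ (s1, 0) :=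
        HasFDerivAt.comp (s1, (0:ℝ)) (g := Φ) hL hmd
      rw [hcomp.fderiv, injective_iff_map_eq_zero]
      rintro ⟨a, b⟩ hab
      have e : fderiv ℝ Φ (0, f s1) (b, fderiv ℝ f s1 a) = b • X i (f s1) + fderiv ℝ f s1 a := by
        rw [← hL1, ← map_smul]
        conv_rhs => rw [← hL2 (fderiv ℝ f s1 a)]
        rw [← map_add]; simp
      have hab' : b • X i (f s1) + fderiv ℝ f s1 a = 0 := by rw [← e]; exact hab
      have hb : b = 0 := by
        by_contra hb
        apply hs1
        refine ⟨- b⁻¹ • a, ?_⟩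
        rw [map_smul, eq_neg_of_add_eq_zero_right hab']
        simp [smul_smul, hb]
      subst hb
      have ha : a = 0 := hi1 (by simpa using hab')
      rw [ha]; rfl
    · have b1 : ∀ᶠ q in 𝓝 (s1, (0:ℝ)), Transp U D x0 (f q.1) :=
        (continuous_fst.tendsto (s1, (0:ℝ))).eventually hT1
      have b2 := hm.continuousAt.eventually hΦj.eventually_nhds
      have b3 := hm.continuousAt.eventually (hΦ.eventually (by simp))
      filter_upwards [b1, b2, b3] with q c1 c2 c3
      have hc : Continuous (fun y : E => (q.2, y)) := by fun_prop
      refine c1.trans ⟨fun y => Φ (q.2, y), ?_, rfl, ?_⟩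
      · exact ContinuousAt.comp (g := Φ) c3.continuousAt hc.continuousAt
      · exact (hc.tendsto (f q.1)).eventually c2

lemma local_joined [FiniteDimensional ℝ E] {p : ℕ} {U : Set E} (hU : IsOpen U) {X : Fin p → E → E}
    (hX : ∀ i, ContDiffOn ℝ (⊤ : ℕ∞) (X i) U) {D : E → Submodule ℝ E} (hD : ∀ i x, X i x ∈ D x)
    (hspan : ∀ x ∈ U, Submodule.span ℝ {v | ∃ l : List (Fin p), v = nestedBracket X l x} = ⊤)
    {x0 : E} (hx0 : x0 ∈ U) : ∀ᶠ y in 𝓝 x0, DJoined U D x0 y := by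
  obtain ⟨S, _, _, _, f, s0, hS, hf, hi, hT⟩ := krener hU hX hD hspan hx0 _ le_rfl
  have : CompleteSpace S := FiniteDimensional.complete ℝ S
  have : CompleteSpace E := FiniteDimensional.complete ℝ E
  have hs : Function.Surjective (fderiv ℝ f s0 : S →ₗ[ℝ] E) :=
    (LinearMap.injective_iff_surjective_of_finrank_eq_finrank hS).1 hi
  have hmap := (hf.hasStrictFDerivAt (by simp)).map_nhds_eq_of_surj (LinearMap.range_eq_top.2 hs)
  have h1 : ∀ᶠ y in 𝓝 (f s0), DJoined U D x0 y := by
    rw [← hmap, eventually_map]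
    exact hT.mono fun s h => h.djoined
  obtain ⟨h, a1, a2, a3⟩ := hT.self_of_nhds
  rw [← a2] at h1
  filter_upwards [a1.eventually h1, a3] with y c1 c2
  exact Relation.ReflTransGen.trans c1 c2.symm
end Geo

end Helpers

/-- **Chow–Rashevskii theorem, bracket-generating case.**  If `U ⊆ ℝ^N` is a connected open
set, `X_1, …, X_p` are C^∞ vector fields on `U` and there is `μ ≥ 1` such that at every
point of `U` the nested brackets of length `≤ μ` span all of `ℝ^N`, then any two points of
`U` are joined by a D-path in `U`, where `D_y = span{X_1(y), …, X_p(y)}`. -/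
theorem chow_rashevskii_bracket_generating
    {N p : ℕ} (U : Set (EuclideanSpace ℝ (Fin N)))
    (hUopen : IsOpen U) (hUconn : IsConnected U)
    (X : Fin p → EuclideanSpace ℝ (Fin N) → EuclideanSpace ℝ (Fin N))
    (hX : ∀ i, ContDiffOn ℝ (⊤ : ℕ∞) (X i) U)
    (μ : ℕ) (hμ : 1 ≤ μ)
    (hbracket : ∀ x ∈ U,
      Submodule.span ℝ
        {v | ∃ l : List (Fin p), l ≠ [] ∧ l.length ≤ μ ∧ v = nestedBracket X l x} = ⊤)
    (x x' : EuclideanSpace ℝ (Fin N)) (hx : x ∈ U) (hx' : x' ∈ U) :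
    DJoined U (fun y => Submodule.span ℝ (Set.range fun i => X i y)) x x' := by
  refine hUconn.isPreconnected.induction₂ _ (fun y hy => ?_) (fun a b c _ _ _ h1 h2 => ?_)
    (fun a b _ _ h => ?_) hx hx'
  · refine Filter.Eventually.filter_mono nhdsWithin_le_nhds ?_
    refine local_joined hUopen hX (fun i y => Submodule.subset_span (Set.mem_range_self i)) ?_ hy
    intro z hz
    rw [← top_le_iff, ← hbracket z hz]
    refine Submodule.span_mono ?_
    rintro v ⟨l, _, _, rfl⟩
    exact ⟨l, rfl⟩
  · exact Relation.ReflTransGen.trans h1 h2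
  · exact DJoined.symm h
end
end

section
/- Let X_1, …, X_p be C^∞ complete vector fields on ℝ^N. For each r-tuple (i_1,…,i_r) with 1 ≤ i_j ≤ p define the one-parameter family of diffeomorphisms G_{(i_1,…,i_r)t} inductively by G_{(k)t} = Φ^{X_k}_t and G_{(k,ℓ_1,…,ℓ_{r−1})t} = Φ^{X_k}_{−t} ∘ G_{(ℓ_1,…,ℓ_{r−1})t} ∘ Φ^{X_k}_{t} ∘ (G_{(ℓ_1,…,ℓ_{r−1})t})^{−1}. Then for every y ∈ ℝ^N: G_{(i_1,…,i_r)0}(y) = y; the derivatives d^j/dt^j G_{(i_1,…,i_r)t}(y) at t = 0 vanish for all 1 ≤ j ≤ r−1; and d^r/dt^r G_{(i_1,…,i_r)t}(y) at t = 0 equals r!·X_{(i_1,…,i_r)}(y). -/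
noncomputable section
open Set

variable {E : Type*} [NormedAddCommGroup E] [NormedSpace ℝ E]

/-- The iterated flow-commutator `G_{(i₁,…,i_r)t}` together with its inverse, defined
inductively from the flows `Φ i` of the vector fields `X i` by `G_{(k)t} = Φ^{X_k}_t` and
`G_{(k,ℓ₁,…,ℓ_{r−1})t} = Φ^{X_k}_{−t} ∘ G_{(ℓ₁,…,ℓ_{r−1})t} ∘ Φ^{X_k}_{t} ∘ (G_{(ℓ₁,…,ℓ_{r−1})t})⁻¹`.
The first component is `G`, the second its inverse (valid when the `Φ i` satisfy the flow
group law). -/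
def GmapPair {p : ℕ} (Φ : Fin p → ℝ → E → E) : List (Fin p) → ℝ → (E → E) × (E → E)
  | [], _ => (id, id)
  | [k], t => (Φ k t, Φ k (-t))
  | k :: j :: l, t =>
      let P := GmapPair Φ (j :: l) t
      (Φ k (-t) ∘ P.1 ∘ Φ k t ∘ P.2, P.1 ∘ Φ k (-t) ∘ P.2 ∘ Φ k t)

section Helpers
set_option linter.unusedSectionVars false
open scoped ContDiff Topology unitInterval
open Filter

variable {V W : Type} [NormedAddCommGroup V] [NormedSpace ℝ V] [NormedAddCommGroup W]
  [NormedSpace ℝ W]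

/-- Primitive operator on curves. -/
def Jop (V : Type) [NormedAddCommGroup V] [NormedSpace ℝ V] : C(I, V) →L[ℝ] C(I, V) :=
  LinearMap.mkContinuous
    { toFun := fun u => ⟨fun s => ∫ τ in (0:ℝ)..s, u (projIcc 0 1 zero_le_one τ), by
        have h : Continuous fun τ : ℝ => u (projIcc 0 1 zero_le_one τ) :=
          u.continuous.comp continuous_projIcc
        exact (intervalIntegral.continuous_primitive
          (fun a b => h.intervalIntegrable a b) 0).comp continuous_subtype_val⟩
      map_add' := fun u v => by
        ext s
        have h : ∀ w : C(I, V), Continuous fun τ : ℝ => w (projIcc 0 1 zero_le_one τ) :=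
          fun w => w.continuous.comp continuous_projIcc
        simpa using intervalIntegral.integral_add ((h u).intervalIntegrable 0 s)
          ((h v).intervalIntegrable 0 s)
      map_smul' := fun c u => by
        ext s
        simp }
    1 (fun u => by
      rw [one_mul, ContinuousMap.norm_le _ (norm_nonneg _)]
      intro s
      have := intervalIntegral.norm_integral_le_of_norm_le_const (a := 0) (b := (s:ℝ))
        (f := fun τ : ℝ => u (projIcc 0 1 zero_le_one τ)) (C := ‖u‖)
        (fun x _ => u.norm_coe_le_norm _)
      refine this.trans ?_
      rw [sub_zero, abs_of_nonneg s.2.1]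
      exact mul_le_of_le_one_right (norm_nonneg _) s.2.2)

theorem Jop_apply (u : C(I, V)) (s : I) :
    Jop V u s = ∫ τ in (0:ℝ)..s, u (projIcc 0 1 zero_le_one τ) := rfl

/-- Pointwise application. -/
def appOp (V W : Type) [NormedAddCommGroup V] [NormedSpace ℝ V] [NormedAddCommGroup W]
  [NormedSpace ℝ W] : C(I, V →L[ℝ] W) →L[ℝ] C(I, V) →L[ℝ] C(I, W) :=
  LinearMap.mkContinuous₂
    (LinearMap.mk₂ ℝ (fun (A : C(I, V →L[ℝ] W)) (h : C(I, V)) =>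
      (⟨fun s => A s (h s), A.continuous.clm_apply h.continuous⟩ : C(I, W)))
      (fun _ _ _ => by ext; simp) (fun _ _ _ => by ext; simp)
      (fun _ _ _ => by ext; simp) (fun _ _ _ => by ext; simp))
    1 (fun A h => by
      rw [one_mul, ContinuousMap.norm_le _ (by positivity)]
      intro s
      exact (A s).le_of_opNorm_le_of_le (A.norm_coe_le_norm s) (h.norm_coe_le_norm s))

theorem appOp_apply (A : C(I, V →L[ℝ] W)) (h : C(I, V)) (s : I) :
    appOp V W A h s = A s (h s) := rfl

/-- Composition operator. -/
def nem (f : V → W) (hf : Continuous f) (u : C(I, V)) : C(I, W) := (⟨f, hf⟩ : C(V, W)).comp u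

theorem nem_apply (f : V → W) (hf : Continuous f) (u : C(I, V)) (s : I) :
    nem f hf u s = f (u s) := rfl

theorem nem_continuous (f : V → W) (hf : Continuous f) : Continuous (nem f hf) :=
  ContinuousMap.continuous_postcomp _

theorem nem_hasFDerivAt (f : V → W) (hf : ContDiff ℝ ∞ f)
    (hf' : Continuous (fderiv ℝ f)) (u : C(I, V)) :
    HasFDerivAt (nem f hf.continuous) (appOp V W (nem (fderiv ℝ f) hf' u)) u := by
  rw [hasFDerivAt_iff_isLittleO_nhds_zero, Asymptotics.isLittleO_iff]
  intro c hc
  have hcont := (nem_continuous (fderiv ℝ f) hf').continuousAt (x := u)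
  rw [Metric.continuousAt_iff] at hcont
  obtain ⟨δ, hδ, hd⟩ := hcont c hc
  filter_upwards [Metric.ball_mem_nhds (0 : C(I, V)) hδ] with h hh
  rw [mem_ball_zero_iff] at hh
  rw [ContinuousMap.norm_le _ (by positivity)]
  intro s
  have key : ∀ z ∈ Metric.ball (u s) δ, ‖fderiv ℝ f z - fderiv ℝ f (u s)‖ ≤ c := by
    intro z hz
    have h1 : dist (u + ContinuousMap.const I (z - u s)) u < δ := by
      rw [dist_eq_norm, add_sub_cancel_left]
      refine lt_of_le_of_lt ((ContinuousMap.norm_le _ (norm_nonneg (z - u s))).2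
        (fun _ => le_rfl)) ?_
      rwa [← dist_eq_norm]
    have h2 := hd h1
    rw [dist_eq_norm] at h2
    have h3 := (ContinuousMap.norm_coe_le_norm _ s).trans h2.le
    simpa [nem_apply] using h3
  have hhs : ‖h s‖ < δ := (h.norm_coe_le_norm s).trans_lt hh
  have := (convex_ball (u s) δ).norm_image_sub_le_of_norm_hasFDerivWithin_le'
    (f := f) (f' := fderiv ℝ f) (φ := fderiv ℝ f (u s)) (C := c)
    (fun z _ => ((hf.differentiable (by simp)) z).hasFDerivAt.hasFDerivWithinAt)
    key (Metric.mem_ball_self hδ) (y := u s + h s) (by simpa using hhs)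
  simp only [add_sub_cancel_left] at this
  refine le_trans ?_ (this.trans (mul_le_mul_of_nonneg_left (h.norm_coe_le_norm s) hc.le))
  simp [nem_apply, appOp_apply]

theorem nem_contDiff_nat (n : ℕ) : ∀ {W : Type} [NormedAddCommGroup W] [NormedSpace ℝ W]
    (f : V → W) (hf : ContDiff ℝ ∞ f), ContDiff ℝ n (nem f hf.continuous) := by
  induction n with
  | zero => 
    intro W _ _ f hf
    exact contDiff_zero.2 (nem_continuous _ _)
  | succ n ih =>
    intro W _ _ f hf
    have hf1 : ContDiff ℝ ∞ (fderiv ℝ f) := hf.fderiv_right (by simp)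
    have hL : ContDiff ℝ n (fun A : C(I, V →L[ℝ] W) => appOp V W A) :=
      by fun_prop
    push_cast
    rw [contDiff_succ_iff_hasFDerivAt]
    exact ⟨fun u => appOp V W (nem (fderiv ℝ f) hf1.continuous u),
      hL.comp (ih _ hf1), fun u => nem_hasFDerivAt f hf hf1.continuous u⟩

theorem nem_contDiff (f : V → W) (hf : ContDiff ℝ ∞ f) : ContDiff ℝ ∞ (nem f hf.continuous) :=
  contDiff_infty.2 fun n => nem_contDiff_nat n f hf

/-- Hadamard factorization. -/
theorem hadamard [CompleteSpace W] (f : ℝ × V → W) (hf : ContDiff ℝ ∞ f) (h0 : ∀ p, f (0, p) = 0) :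
    ∃ g : ℝ × V → W, ContDiff ℝ ∞ g ∧ ∀ t p, f (t, p) = t • g (t, p) := by
  have hd : ContDiff ℝ ∞ (fun q : ℝ × V => fderiv ℝ f q (1, 0)) :=
    (hf.fderiv_right (by simp)).clm_apply contDiff_const
  let ray : ℝ × V →L[ℝ] C(I, ℝ × V) := LinearMap.mkContinuous
    { toFun := fun q => ⟨fun s => (s * q.1, q.2), by fun_prop⟩
      map_add' := fun a b => by ext <;> simp [mul_add]
      map_smul' := fun a b => by ext <;> simp; ring } 1 (fun q => by
        rw [one_mul, ContinuousMap.norm_le _ (norm_nonneg _)]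
        intro s
        refine max_le ?_ (norm_snd_le q)
        refine le_trans ?_ (norm_fst_le q)
        change ‖(s:ℝ) * q.1‖ ≤ _
        rw [norm_mul]
        refine mul_le_of_le_one_left (norm_nonneg _) ?_
        rw [Real.norm_of_nonneg s.2.1]
        exact s.2.2)
  have hray : ∀ q s, ray q s = (s * q.1, q.2) := fun _ _ => rfl
  refine ⟨fun q => ContinuousMap.evalCLM ℝ (1 : I) (Jop W (nem _ hd.continuous (ray q))), ?_, ?_⟩
  · exact (ContinuousLinearMap.contDiff _).comp ((Jop W).contDiff.comp
      ((nem_contDiff _ hd).comp ray.contDiff))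
  · intro t p
    change _ = t • Jop W _ 1
    rw [Jop_apply, ← intervalIntegral.integral_smul]
    have hder : ∀ s : ℝ, HasDerivAt (fun s : ℝ => f (s * t, p))
        (t • fderiv ℝ f (s * t, p) (1, 0)) s := by
      intro s
      have h1 : HasDerivAt (fun s : ℝ => (s * t, p)) (t, 0) s := by
        simpa using ((hasDerivAt_id s).mul_const t).prodMk (hasDerivAt_const s p)
      have h2 := ((hf.differentiable (by simp)) (s * t, p)).hasFDerivAt.comp_hasDerivAt s h1
      convert! h2 using 1
      rw [← map_smul]; simp
    have := intervalIntegral.integral_eq_sub_of_hasDerivAt (a := 0) (b := 1)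
      (fun s _ => hder s) (by
        apply Continuous.intervalIntegrable
        have := hd.continuous
        have h3 : Continuous fun s : ℝ => (s * t, p) := by fun_prop
        exact continuous_const.smul (this.comp h3))
    simp only [one_mul, zero_mul, h0, sub_zero] at this
    rw [← this]
    apply intervalIntegral.integral_congr
    intro s hs
    simp only [zero_le_one, uIcc_of_le] at hs
    simp only [nem_apply, hray, projIcc_of_mem zero_le_one hs]

theorem lip_closedBall [ProperSpace V] (X : V → W) (hX : ContDiff ℝ ∞ X) (R : ℝ) :
    ∃ K, LipschitzOnWith K X (Metric.closedBall 0 R) := by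
  have hc : Continuous (fderiv ℝ X) := hX.continuous_fderiv (by simp)
  obtain ⟨C, hC⟩ := (isCompact_closedBall (0 : V) R).exists_bound_of_continuousOn hc.continuousOn
  refine ⟨C.toNNReal, (convex_closedBall (0:V) R).lipschitzOnWith_of_nnnorm_fderiv_le
    (fun x _ => hX.differentiable (by simp) x) (fun x hx => ?_)⟩
  rw [← norm_toNNReal]
  exact Real.toNNReal_le_toNNReal (hC x hx)

theorem flow_unique [ProperSpace V] (X : V → V) (hX : ContDiff ℝ ∞ X) (f g : ℝ → V)
    (hf : Continuous f) (hg : Continuous g)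
    (hf' : ∀ t ∈ Ico (0:ℝ) 1, HasDerivAt f (X (f t)) t)
    (hg' : ∀ t ∈ Ico (0:ℝ) 1, HasDerivAt g (X (g t)) t) (h0 : f 0 = g 0) : f 1 = g 1 := by
  obtain ⟨C1, hC1⟩ := (isCompact_Icc (a := (0:ℝ)) (b := 1)).exists_bound_of_continuousOn
    hf.continuousOn
  obtain ⟨C2, hC2⟩ := (isCompact_Icc (a := (0:ℝ)) (b := 1)).exists_bound_of_continuousOn
    hg.continuousOn
  obtain ⟨K, hK⟩ := lip_closedBall X hX (max C1 C2)
  refine ODE_solution_unique_of_mem_Icc_right (v := fun _ => X) (K := K) (a := 0) (b := 1)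
    (s := fun _ => Metric.closedBall 0 (max C1 C2)) (fun _ _ => hK) hf.continuousOn
    (fun t ht => (hf' t ht).hasDerivWithinAt) (fun t ht => ?_) hg.continuousOn
    (fun t ht => (hg' t ht).hasDerivWithinAt) (fun t ht => ?_) h0
    (right_mem_Icc.2 zero_le_one)
  · simpa using Or.inl (hC1 t (Ico_subset_Icc_self ht))
  · simpa using Or.inr (hC2 t (Ico_subset_Icc_self ht))

theorem flow_contDiffAt_zero [CompleteSpace V] [ProperSpace V] (X : V → V) (hX : ContDiff ℝ ∞ X)
    (Φ : ℝ → V → V) (hΦ0 : ∀ y, Φ 0 y = y)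
    (hΦ : ∀ t y, HasDerivAt (fun s => Φ s y) (X (Φ t y)) t) (n : ℕ) (hn : n ≠ 0) (x₀ : V) :
    ContDiffAt ℝ n (fun q : ℝ × V => Φ q.1 q.2) (0, x₀) := by
  let F : (ℝ × V) × C(I, V) → C(I, V) := fun z =>
    z.2 - ContinuousLinearMap.const ℝ I z.1.2 - z.1.1 • Jop V (nem X hX.continuous z.2)
  let u : (ℝ × V) × C(I, V) := ((0, x₀), ContinuousLinearMap.const ℝ I x₀)
  have hF : ContDiff ℝ n F := by
    have h1 : ContDiff ℝ n (nem X hX.continuous) := nem_contDiff_nat n X hX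
    have h2 : ContDiff ℝ n (fun z : (ℝ × V) × C(I, V) => nem X hX.continuous z.2) :=
      h1.comp contDiff_snd
    fun_prop
  have hn' : (n : WithTop ℕ∞) ≠ 0 := by exact_mod_cast hn
  have hinv : (fderiv ℝ F u ∘L .inr ℝ (ℝ × V) C(I, V)).IsInvertible := by
    refine ⟨ContinuousLinearEquiv.refl ℝ _, ?_⟩
    have h1 : HasFDerivAt F (fderiv ℝ F u) ((0, x₀), u.2) :=
      (hF.differentiable hn' u).hasFDerivAt
    have h2 := h1.comp u.2 (hasFDerivAt_prodMk_right (𝕜 := ℝ) ((0:ℝ), x₀) u.2)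
    have h3 : HasFDerivAt (fun w : C(I, V) => w - ContinuousLinearMap.const ℝ I x₀)
        (ContinuousLinearMap.id ℝ _) u.2 := (hasFDerivAt_id _).sub_const _
    refine HasFDerivAt.unique (x := u.2) h3 ?_
    convert! h2 using 1
    funext w
    simp [F]
  have hFu : F u = 0 := by simp [F, u]
  have hψ := hF.contDiffAt.contDiffAt_implicitFunction hn' hinv
  have hev := hF.contDiffAt.eventually_apply_implicitFunction hn' hinv
  set ψ := hF.contDiffAt.implicitFunction hn' hinv
  have hfin : ContDiffAt ℝ n (fun q => ContinuousMap.evalCLM ℝ (1 : I) (ψ q)) (0, x₀) :=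
    (ContinuousLinearMap.contDiff _).contDiffAt.comp _ hψ
  refine hfin.congr_of_eventuallyEq ?_
  filter_upwards [hev] with q hq
  obtain ⟨t, x⟩ := q
  rw [hFu] at hq
  set w := ψ (t, x)
  have hw : ∀ s : I, w s = x + t • ∫ τ in (0:ℝ)..s, X (w (projIcc 0 1 zero_le_one τ)) := by
    intro s
    have h := congrArg (fun c : C(I, V) => c s) hq
    have h' : w s - x - t • Jop V (nem X hX.continuous w) s = 0 := h
    rw [sub_sub, sub_eq_zero] at h'
    exact h'
  have hcw : Continuous fun τ : ℝ => X (w (projIcc 0 1 zero_le_one τ)) :=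
    hX.continuous.comp (w.continuous.comp continuous_projIcc)
  let f : ℝ → V := fun s => x + t • ∫ τ in (0:ℝ)..s, X (w (projIcc 0 1 zero_le_one τ))
  have hfd : ∀ s, HasDerivAt f (t • X (w (projIcc 0 1 zero_le_one s))) s := fun s =>
    ((hcw.integral_hasStrictDerivAt 0 s).hasDerivAt.const_smul t).const_add x
  have hgd : ∀ s, HasDerivAt (fun s => Φ (s * t) x) (t • X (Φ (s * t) x)) s := by
    intro s
    have := (hΦ (s * t) x).scomp s ((hasDerivAt_id s).mul_const t)
    simpa using! this
  have := flow_unique (fun y => t • X y) (hX.const_smul t) f (fun s => Φ (s * t) x)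
    (continuous_iff_continuousAt.2 fun s => (hfd s).continuousAt)
    (continuous_iff_continuousAt.2 fun s => (hgd s).continuousAt)
    (fun s hs => by
      have h := hfd s
      have h1 : f s = w (projIcc 0 1 zero_le_one s) := by
        rw [hw, projIcc_of_mem zero_le_one (Ico_subset_Icc_self hs)]
      simpa only [h1] using h) (fun s _ => hgd s) (by simp [f, hΦ0])
  simp only [one_mul] at this
  change Φ t x = w 1
  rw [← this, hw]
  rfl

theorem flow_contDiff [CompleteSpace V] [ProperSpace V] (X : V → V) (hX : ContDiff ℝ ∞ X)
    (Φ : ℝ → V → V) (hΦ0 : ∀ y, Φ 0 y = y)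
    (hadd : ∀ s t y, Φ (s + t) y = Φ s (Φ t y))
    (hΦ : ∀ t y, HasDerivAt (fun s => Φ s y) (X (Φ t y)) t) :
    ContDiff ℝ ∞ (fun q : ℝ × V => Φ q.1 q.2) := by
  suffices H : ∀ n : ℕ, ContDiff ℝ (n+1 : ℕ) (fun q : ℝ × V => Φ q.1 q.2) from
    contDiff_infty.2 fun n => (H n).of_le (by exact_mod_cast Nat.le_succ n)
  intro n
  rw [contDiff_iff_contDiffAt]
  rintro ⟨t, y⟩
  let P : ℝ → Prop := fun t => ContDiffAt ℝ (n+1 : ℕ) (fun q : ℝ × V => Φ q.1 q.2) (t, y)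
  have h0 := flow_contDiffAt_zero X hX Φ hΦ0 hΦ (n+1) (by simp)
  have hP0 : P 0 := h0 y
  suffices H : (P 0 → P t) from H hP0
  refine PreconnectedSpace.induction₂' (fun a b => P a → P b) (fun a => ?_)
    ⟨fun _ _ _ h1 h2 h => h2 (h1 h)⟩ 0 t
  have hstep : ∀ t' t, ContDiffAt ℝ (n+1 : ℕ) (fun q : ℝ × V => Φ q.1 q.2) (t - t', Φ t' y) →
      P t' → P t := by
    intro t' t h1 h2
    have h3 : ContDiffAt ℝ (n+1 : ℕ) (fun q : ℝ × V => Φ t' q.2) (t, y) := 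
      ContDiffAt.comp (t, y) (f := fun q : ℝ × V => (t', q.2)) h2 (by fun_prop)
    have h4 : ContDiffAt ℝ (n+1 : ℕ) (fun q : ℝ × V => (q.1 - t', Φ t' q.2)) (t, y) :=
      (by fun_prop : ContDiffAt ℝ (n+1 : ℕ) (fun q : ℝ × V => q.1 - t') (t, y)).prodMk h3
    have h5 := ContDiffAt.comp (t, y) (f := fun q : ℝ × V => (q.1 - t', Φ t' q.2)) h1 h4
    refine h5.congr_of_eventuallyEq (Eventually.of_forall fun q => ?_)
    simp [← hadd]
  have hev : ∀ᶠ q in 𝓝 ((0:ℝ), Φ a y),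
      ContDiffAt ℝ (n+1 : ℕ) (fun q : ℝ × V => Φ q.1 q.2) q := (h0 (Φ a y)).eventually (by simp)
  have hca : ContinuousAt (fun s => Φ s y) a := (hΦ a y).continuousAt
  have t1 : Tendsto (fun b => (b - a, Φ a y)) (𝓝 a) (𝓝 ((0:ℝ), Φ a y)) := by
    have : ContinuousAt (fun b => (b - a, Φ a y)) a := by fun_prop
    simpa [ContinuousAt] using this
  have t2 : Tendsto (fun b => (a - b, Φ b y)) (𝓝 a) (𝓝 ((0:ℝ), Φ a y)) := by
    have : ContinuousAt (fun b => (a - b, Φ b y)) a := by fun_prop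
    simpa [ContinuousAt] using this
  filter_upwards [t1.eventually hev, t2.eventually hev] with b hb1 hb2
  exact ⟨hstep a b hb1, hstep b a hb2⟩

theorem had_deriv (f g : ℝ × V → W) (hg : Continuous g) (h : ∀ t p, f (t, p) = t • g (t, p))
    (p : V) {d : W} (hd : HasDerivAt (fun t => f (t, p)) d 0) : g (0, p) = d := by
  have h1 : HasDerivAt (fun t => f (t, p)) (g (0, p)) 0 := by
    rw [hasDerivAt_iff_tendsto_slope]
    have h2 : Tendsto (fun t : ℝ => g (t, p)) (𝓝[≠] 0) (𝓝 (g (0, p))) := by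
      have : Continuous fun t : ℝ => g (t, p) := by fun_prop
      exact (this.tendsto 0).mono_left nhdsWithin_le_nhds
    refine h2.congr' ?_
    filter_upwards [self_mem_nhdsWithin] with t ht
    have ht' : t ≠ 0 := ht
    simp [slope_def_module, h, smul_smul, ht']
  exact h1.unique hd

theorem step_lemma [CompleteSpace V] (X Z : V → V) (hX : Differentiable ℝ X)
    (Φ G H : ℝ → V → V)
    (sΦ : ContDiff ℝ ∞ (fun q : ℝ × V => Φ q.1 q.2))
    (sH : ContDiff ℝ ∞ (fun q : ℝ × V => H q.1 q.2))
    (hΦ0 : ∀ y, Φ 0 y = y) (hadd : ∀ s t y, Φ (s + t) y = Φ s (Φ t y))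
    (hGH : ∀ t y, G t (H t y) = y)
    (φ g : ℝ × V → V) (sφ : ContDiff ℝ ∞ φ) (sg : ContDiff ℝ ∞ g)
    (hφ : ∀ t y, Φ t y = y + t • φ (t, y)) (hφ0 : ∀ y, φ (0, y) = X y)
    (m : ℕ) (hm : m ≠ 0)
    (hg : ∀ t y, G t y = y + t ^ m • g (t, y)) (hg0 : ∀ y, g (0, y) = Z y) :
    ∃ k : ℝ × V → V, ContDiff ℝ ∞ k ∧
      (∀ t y, Φ (-t) (G t (Φ t (H t y))) = y + t ^ (m + 1) • k (t, y)) ∧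
      ∀ y, k (0, y) = lieBracket X Z y := by
  obtain ⟨P, sP, hP⟩ := hadamard (fun q : ℝ × V => g (q.1, Φ q.1 q.2) - g q)
    ((sg.comp (contDiff_fst.prodMk sΦ)).sub sg) (fun p => by simp [hΦ0])
  obtain ⟨Q, sQ, hQ⟩ := hadamard (fun q : ℝ × (ℝ × V) =>
      φ (q.2.1, q.2.2 + q.1 • g q.2) - φ q.2) (by fun_prop) (fun p => by simp)
  have hP0 : ∀ w, P (0, w) = fderiv ℝ Z w (X w) := by
    intro w
    refine had_deriv (fun q : ℝ × V => g (q.1, Φ q.1 q.2) - g q) P sP.continuous hP w ?_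
    have dg : HasFDerivAt g (fderiv ℝ g (0, w)) (0, w) :=
      (sg.differentiable (by simp) _).hasFDerivAt
    have dΦ : HasDerivAt (fun t => Φ t w) (X w) 0 := by
      have h1 : HasDerivAt (fun t : ℝ => t • φ (t, w))
          ((0:ℝ) • deriv (fun t => φ (t, w)) 0 + (1:ℝ) • φ (0, w)) 0 := by
        refine (hasDerivAt_id (0:ℝ)).smul (DifferentiableAt.hasDerivAt ?_)
        have := sφ.differentiable (by simp)
        fun_prop
      have h2 := h1.const_add w
      simp only [zero_smul, zero_add, one_smul, hφ0] at h2
      exact h2.congr_of_eventuallyEq (Eventually.of_forall fun t => hφ t w)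
    have dg' : HasFDerivAt g (fderiv ℝ g (0, w)) (0, Φ 0 w) := by rw [hΦ0]; exact dg
    have e1 := dg'.comp_hasDerivAt (0:ℝ) ((hasDerivAt_id (0:ℝ)).prodMk dΦ)
    have e2 := dg.comp_hasDerivAt (0:ℝ) ((hasDerivAt_id (0:ℝ)).prodMk (hasDerivAt_const (0:ℝ) w))
    have e3 := e1.sub e2
    have dZ : HasFDerivAt Z ((fderiv ℝ g (0, w)).comp (.inr ℝ ℝ V)) w := by
      have := dg.comp w (hasFDerivAt_prodMk_right (𝕜 := ℝ) (0:ℝ) w)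
      refine this.congr_of_eventuallyEq (Eventually.of_forall fun y => (hg0 y).symm)
    convert! e3 using 1
    rw [dZ.fderiv, ← map_sub]
    simp
  have hQ0 : ∀ w, Q (0, (0, w)) = fderiv ℝ X w (Z w) := by
    intro w
    refine had_deriv (fun q : ℝ × (ℝ × V) =>
      φ (q.2.1, q.2.2 + q.1 • g q.2) - φ q.2) Q sQ.continuous hQ (0, w) ?_
    simp only [hφ0, hg0]
    have e1 : HasDerivAt (fun τ : ℝ => w + τ • Z w) (Z w) 0 := by
      simpa using ((hasDerivAt_id (0:ℝ)).smul_const (Z w)).const_add w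
    have e2 : HasFDerivAt X (fderiv ℝ X w) (w + (0:ℝ) • Z w) := by
      simpa using (hX w).hasFDerivAt
    exact (e2.comp_hasDerivAt (0:ℝ) e1).sub_const _
  let B : ℝ × V → V := fun q => P q - Q (q.1 ^ m, q)
  have sB : ContDiff ℝ ∞ B := by fun_prop
  have hB0 : ∀ w, B (0, w) = lieBracket X Z w := by
    intro w
    simp only [B, zero_pow hm, hP0, hQ0, lieBracket]
  have hA : ∀ t w, G t (Φ t w) = Φ t (G t w) + t ^ (m + 1) • B (t, w) := by
    intro t w
    have p1 := hP t w
    have q1 := hQ (t ^ m) (t, w)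
    simp only [← hg] at p1 q1
    rw [sub_eq_iff_eq_add] at p1 q1
    rw [hg t (Φ t w), p1, hφ t (G t w), q1]
    simp only [B]
    rw [hφ t w, hg t w]
    module
  have hH0 : ∀ y, H 0 y = y := by
    intro y
    have := hGH 0 y
    rw [hg] at this
    simpa [hm] using this
  have sR : ContDiff ℝ ∞ (fun q : ℝ × (ℝ × V) =>
      Φ (-q.2.1) (Φ q.2.1 q.2.2 + q.1 • B (q.2.1, H q.2.1 q.2.2)) - q.2.2) := by
    have a1 : ContDiff ℝ ∞ (fun q : ℝ × (ℝ × V) => Φ q.2.1 q.2.2) := sΦ.comp contDiff_snd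
    have a2 : ContDiff ℝ ∞ (fun q : ℝ × (ℝ × V) => H q.2.1 q.2.2) := sH.comp contDiff_snd
    have a3 : ContDiff ℝ ∞ (fun q : ℝ × (ℝ × V) =>
      (-q.2.1, Φ q.2.1 q.2.2 + q.1 • B (q.2.1, H q.2.1 q.2.2))) := by fun_prop
    have a4 := sΦ.comp a3
    exact a4.sub (by fun_prop)
  obtain ⟨R, sR', hR⟩ := hadamard _ sR (fun p => by
    simp only [zero_smul, add_zero, ← hadd, neg_add_cancel, hΦ0, sub_self])
  refine ⟨fun q => R (q.1 ^ (m + 1), q), by fun_prop, fun t y => ?_, fun y => ?_⟩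
  · have := hR (t ^ (m + 1)) (t, y)
    simp only at this
    rw [hA, hGH, ← this]
    abel
  · simp only [zero_pow (Nat.succ_ne_zero m)]
    refine had_deriv (fun q : ℝ × (ℝ × V) =>
      Φ (-q.2.1) (Φ q.2.1 q.2.2 + q.1 • B (q.2.1, H q.2.1 q.2.2)) - q.2.2) R sR'.continuous hR (0, y) ?_
    simp only [neg_zero, hΦ0, hH0, hB0]
    simpa using ((((hasDerivAt_id (0:ℝ)).smul_const (lieBracket X Z y)).const_add y).sub_const y)

theorem G_expand {p : ℕ} [CompleteSpace V] [ProperSpace V] (X : Fin p → V → V)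
    (hX : ∀ i, ContDiff ℝ ∞ (X i)) (Φ : Fin p → ℝ → V → V)
    (hΦ0 : ∀ i y, Φ i 0 y = y)
    (hΦadd : ∀ i s t y, Φ i (s + t) y = Φ i s (Φ i t y))
    (hΦderiv : ∀ i t y, HasDerivAt (fun s => Φ i s y) (X i (Φ i t y)) t) (l : List (Fin p)) :
    l ≠ [] →
    ContDiff ℝ ∞ (fun q : ℝ × V => (GmapPair Φ l q.1).1 q.2) ∧
    ContDiff ℝ ∞ (fun q : ℝ × V => (GmapPair Φ l q.1).2 q.2) ∧
    (∀ t y, (GmapPair Φ l t).1 ((GmapPair Φ l t).2 y) = y) ∧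
    (∀ t y, (GmapPair Φ l t).2 ((GmapPair Φ l t).1 y) = y) ∧
    ∃ g : ℝ × V → V, ContDiff ℝ ∞ g ∧
      (∀ t y, (GmapPair Φ l t).1 y = y + t ^ l.length • g (t, y)) ∧
      ∀ y, g (0, y) = nestedBracket X l y := by
  have sΦ := fun i => flow_contDiff (X i) (hX i) (Φ i) (hΦ0 i) (hΦadd i) (hΦderiv i)
  have sΦn : ∀ i, ContDiff ℝ ∞ (fun q : ℝ × V => Φ i (-q.1) q.2) := fun i =>
    (sΦ i).comp (contDiff_fst.neg.prodMk contDiff_snd)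
  have inv1 : ∀ i t y, Φ i t (Φ i (-t) y) = y := fun i t y => by
    rw [← hΦadd, add_neg_cancel, hΦ0]
  have inv2 : ∀ i t y, Φ i (-t) (Φ i t y) = y := fun i t y => by
    rw [← hΦadd, neg_add_cancel, hΦ0]
  have base : ∀ i, ∃ g : ℝ × V → V, ContDiff ℝ ∞ g ∧
      (∀ t y, Φ i t y = y + t • g (t, y)) ∧ ∀ y, g (0, y) = X i y := by
    intro i
    obtain ⟨g, sg, hg⟩ := hadamard (fun q : ℝ × V => Φ i q.1 q.2 - q.2)
      ((sΦ i).sub contDiff_snd) (fun p => by simp [hΦ0])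
    refine ⟨g, sg, fun t y => ?_, fun y => ?_⟩
    · rw [← hg]; abel
    · refine had_deriv (fun q : ℝ × V => Φ i q.1 q.2 - q.2) g sg.continuous hg y ?_
      have := (hΦderiv i 0 y).sub_const y
      simpa only [hΦ0] using this
  induction l with
  | nil => intro h; exact absurd rfl h
  | cons i l ih =>
    intro _
    cases l with
    | nil =>
      obtain ⟨g, sg, hg, hg0⟩ := base i
      refine ⟨sΦ i, sΦn i, inv1 i, inv2 i, g, sg, fun t y => ?_, hg0⟩
      simpa [GmapPair] using hg t y
    | cons j l =>
      obtain ⟨sG, sH, hGH, hHG, g, sg, hg, hg0⟩ := ih (by simp)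
      obtain ⟨φ, sφ, hφ, hφ0⟩ := base i
      have e1 : ∀ t y, (GmapPair Φ (i :: j :: l) t).1 y =
        Φ i (-t) ((GmapPair Φ (j :: l) t).1 (Φ i t ((GmapPair Φ (j :: l) t).2 y))) :=
        fun _ _ => rfl
      have e2 : ∀ t y, (GmapPair Φ (i :: j :: l) t).2 y =
        (GmapPair Φ (j :: l) t).1 (Φ i (-t) ((GmapPair Φ (j :: l) t).2 (Φ i t y))) :=
        fun _ _ => rfl
      obtain ⟨k, sk, hk, hk0⟩ := step_lemma (X i) (nestedBracket X (j :: l))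
        ((hX i).differentiable (by simp)) (Φ i) (fun t => (GmapPair Φ (j :: l) t).1)
        (fun t => (GmapPair Φ (j :: l) t).2) (sΦ i) sH (hΦ0 i) (hΦadd i) hGH φ g sφ sg hφ hφ0
        (j :: l).length (by simp) hg hg0
      have cmp : ∀ a b : ℝ × V → V, ContDiff ℝ ∞ a → ContDiff ℝ ∞ b →
        ContDiff ℝ ∞ (fun q : ℝ × V => a (q.1, b q)) := by
        intro a b ha hb
        fun_prop
      refine ⟨?_, ?_, ?_, ?_, k, sk, ?_, hk0⟩
      · simp only [e1]
        exact cmp _ _ (sΦn i) (cmp _ _ sG (cmp _ _ (sΦ i) sH))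
      · simp only [e2]
        exact cmp _ _ sG (cmp _ _ (sΦn i) (cmp _ _ sH (sΦ i)))
      · intro t y
        rw [e1, e2]
        simp only [hHG, hGH, inv1, inv2]
      · intro t y
        rw [e1, e2]
        simp only [hHG, hGH, inv1, inv2]
      · intro t y
        rw [e1]
        exact hk t y

theorem iterDeriv_pow_smul (r : ℕ) : ∀ g : ℝ → V, ContDiff ℝ ∞ g →
    (∀ j < r, iteratedDeriv j (fun t => t ^ r • g t) 0 = 0) ∧
    iteratedDeriv r (fun t => t ^ r • g t) 0 = (r.factorial : ℝ) • g 0 := by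
  induction r with
  | zero => intro g _; simp
  | succ r ih =>
    intro g hg
    have hg' : ContDiff ℝ ∞ (deriv g) := by
      have := (contDiff_infty_iff_deriv.1 hg).2
      exact this
    have hd : deriv (fun t => t ^ (r + 1) • g t) =
        fun t => t ^ r • (((r + 1 : ℕ) : ℝ) • g t + t • deriv g t) := by
      funext t
      have := ((hasDerivAt_pow (r + 1) t).smul
        ((hg.differentiable (by simp)) t).hasDerivAt).deriv
      refine this.trans ?_
      simp only [Nat.add_sub_cancel]
      module
    obtain ⟨h1, h2⟩ := ih (fun t => ((r + 1 : ℕ) : ℝ) • g t + t • deriv g t) (by fun_prop)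
    constructor
    · intro j hj
      cases j with
      | zero => simp
      | succ j =>
        rw [iteratedDeriv_succ', hd]
        exact h1 j (by omega)
    · rw [iteratedDeriv_succ', hd, h2, Nat.factorial_succ]
      push_cast
      simp only [zero_smul, add_zero, smul_smul]
      congr 1
      ring

end Helpers

/-- For C^∞ complete vector fields `X_1, …, X_p` on `ℝ^N` with flows `Φ i`, and any nonempty
tuple `(i₁,…,i_r)` of indices, the iterated flow commutator `G_{(i₁,…,i_r)t}` satisfies
`G_{(i₁,…,i_r)0}(y) = y`, its `t`-derivatives at `t = 0` of order `1 ≤ j ≤ r−1` vanish,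
and its `r`-th derivative at `t = 0` equals `r!·X_{(i₁,…,i_r)}(y)`. -/
theorem iterated_flow_commutator_derivatives
    {N p : ℕ} (X : Fin p → EuclideanSpace ℝ (Fin N) → EuclideanSpace ℝ (Fin N))
    (hX : ∀ i, ContDiff ℝ (⊤ : ℕ∞) (X i))
    (Φ : Fin p → ℝ → EuclideanSpace ℝ (Fin N) → EuclideanSpace ℝ (Fin N))
    (hΦ0 : ∀ i y, Φ i 0 y = y)
    (hΦadd : ∀ i s t y, Φ i (s + t) y = Φ i s (Φ i t y))
    (hΦderiv : ∀ i t y, HasDerivAt (fun s => Φ i s y) (X i (Φ i t y)) t)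
    (l : List (Fin p)) (hl : l ≠ []) (y : EuclideanSpace ℝ (Fin N)) :
    (GmapPair Φ l 0).1 y = y ∧
    (∀ j, 1 ≤ j → j ≤ l.length - 1 →
      iteratedDeriv j (fun t => (GmapPair Φ l t).1 y) 0 = 0) ∧
    iteratedDeriv l.length (fun t => (GmapPair Φ l t).1 y) 0 =
      (Nat.factorial l.length : ℝ) • nestedBracket X l y := by
  obtain ⟨-, -, -, -, g, sg, hg, hg0⟩ := G_expand X hX Φ hΦ0 hΦadd hΦderiv l hl
  have hlen : l.length ≠ 0 := by simpa using hl
  obtain ⟨h1, h2⟩ := iterDeriv_pow_smul l.length (fun t => g (t, y)) (by fun_prop)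
  simp only [hg]
  have key : ∀ j, j ≠ 0 → iteratedDeriv j (fun t : ℝ => y + t ^ l.length • g (t, y)) 0 =
      iteratedDeriv j (fun t : ℝ => t ^ l.length • g (t, y)) 0 := by
    intro j hj
    obtain ⟨j, rfl⟩ := Nat.exists_eq_succ_of_ne_zero hj
    rw [Nat.succ_eq_add_one, iteratedDeriv_succ', iteratedDeriv_succ']
    congr 1
    funext t
    simp
  refine ⟨by simp [hlen], fun j hj1 hj2 => ?_, ?_⟩
  · rw [key j (by omega)]
    exact h1 j (by omega)
  · rw [key _ hlen, h2, hg0]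
end
end

section
/- Let X and Y be C^∞ complete vector fields on ℝ^N with Φ^X_t the flow of X. For every y ∈ ℝ^N, the curve t ↦ D(Φ^X_{−t})(Φ^X_t(y)) · Y(Φ^X_t(y)) (the pushforward of Y by Φ^X_{−t} evaluated at y) is differentiable at t = 0 with derivative equal to the Lie bracket [X, Y](y). -/
noncomputable section
open Set

variable {E : Type*} [NormedAddCommGroup E] [NormedSpace ℝ E]

section helpers
open Metric Filter Topology
open scoped NNReal

variable {F : Type*} [NormedAddCommGroup F] [NormedSpace ℝ F] [FiniteDimensional ℝ F]

lemma aux_lip {G : Type*} [NormedAddCommGroup G] [NormedSpace ℝ G]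
    (X : F → G) (hX : ContDiff ℝ 1 X) (c : F) (R : ℝ) :
    ∃ K : ℝ≥0, LipschitzOnWith K X (closedBall c R) :=
  hX.contDiffOn.exists_lipschitzOnWith one_ne_zero (convex_closedBall c R)
    (isCompact_closedBall c R)

lemma aux_uniq (X : F → F) (hX : ContDiff ℝ 1 X) {a b t₀ : ℝ} (ht : t₀ ∈ Ioo a b)
    (f g : ℝ → F) (hf : ContinuousOn f (Icc a b)) (hg : ContinuousOn g (Icc a b))
    (hf' : ∀ t ∈ Ioo a b, HasDerivAt f (X (f t)) t)
    (hg' : ∀ t ∈ Ioo a b, HasDerivAt g (X (g t)) t)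
    (h : f t₀ = g t₀) : EqOn f g (Icc a b) := by
  obtain ⟨R₁, h1⟩ := (isCompact_Icc.image_of_continuousOn hf).isBounded.subset_closedBall (0 : F)
  obtain ⟨R₂, h2⟩ := (isCompact_Icc.image_of_continuousOn hg).isBounded.subset_closedBall (0 : F)
  obtain ⟨K, hK⟩ := aux_lip X hX 0 (max R₁ R₂)
  refine ODE_solution_unique_of_mem_Icc (v := fun _ => X)
    (s := fun _ => closedBall 0 (max R₁ R₂)) (K := K) (t₀ := t₀) (fun _ _ => hK) ht hf hf' ?_ hg
    hg' ?_ h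
  · intro t ht
    exact closedBall_subset_closedBall (le_max_left _ _)
      (h1 (mem_image_of_mem _ (Ioo_subset_Icc_self ht)))
  · intro t ht
    exact closedBall_subset_closedBall (le_max_right _ _)
      (h2 (mem_image_of_mem _ (Ioo_subset_Icc_self ht)))

lemma aux_flow_lip (X : F → F) (hX : ContDiff ℝ 1 X) (Φ : ℝ → F → F)
    (hΦ0 : ∀ y, Φ 0 y = y)
    (hΦderiv : ∀ t y, HasDerivAt (fun s => Φ s y) (X (Φ t y)) t) (y : F) :
    ∃ ε > 0, ∃ r > 0, ∃ L : ℝ≥0, ∀ t ∈ Icc (-ε) ε, LipschitzOnWith L (Φ t) (closedBall y r) := by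
  obtain ⟨ε, hε, a, r, L, K, hr, H⟩ := IsPicardLindelof.of_contDiffAt_one (hX.contDiffAt (x := y))
  obtain ⟨α, hα, L', hL'⟩ :=
    (H 0).exists_forall_mem_closedBall_eq_hasDerivWithinAt_lipschitzOnWith
  simp only [zero_sub, zero_add] at hα hL'
  refine ⟨ε, hε, r, hr, L', fun t ht => ?_⟩
  suffices hs : EqOn (fun x => α x t) (Φ t) (closedBall y r) by
    intro x hx z hz
    rw [← hs hx, ← hs hz]
    exact hL' t ht hx hz
  intro x hx
  obtain ⟨h0, h1⟩ := hα x hx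
  refine (aux_uniq X hX (t₀ := 0) (a := -ε) (b := ε) ⟨by linarith, hε⟩ (fun s => α x s)
    (fun s => Φ s x) (fun s hs => (h1 s hs).continuousWithinAt)
    (fun s _ => (hΦderiv s x).continuousAt.continuousWithinAt)
    (fun s hs => (h1 s (Ioo_subset_Icc_self hs)).hasDerivAt (Icc_mem_nhds hs.1 hs.2))
    (fun s _ => hΦderiv s x) (by simp [h0, hΦ0])) ht

lemma aux_gronwall {f f' : ℝ → F} {K η T : ℝ} (hf : ∀ t ∈ Icc (-T) T, HasDerivAt f (f' t) t)
    (h0 : f 0 = 0) (hb : ∀ t ∈ Icc (-T) T, ‖f' t‖ ≤ K * ‖f t‖ + η) :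
    ∀ t ∈ Icc (-T) T, ‖f t‖ ≤ gronwallBound 0 K η |t| := by
  intro t ht
  rcases le_total 0 t with h | h
  · have := norm_le_gronwallBound_of_norm_deriv_right_le (f := f) (f' := f') (δ := 0) (K := K)
      (ε := η) (a := 0) (b := T)
      (fun s hs => (hf s ⟨by linarith [hs.1, hs.2], hs.2⟩).continuousAt.continuousWithinAt)
      (fun s hs => (hf s ⟨by linarith [hs.1, hs.2], hs.2.le⟩).hasDerivWithinAt)
      (by simp [h0]) (fun s hs => hb s ⟨by linarith [hs.1, hs.2], hs.2.le⟩) t ⟨h, ht.2⟩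
    simpa [abs_of_nonneg h] using this
  · have hd : ∀ s ∈ Icc (-T) T, HasDerivAt (fun s => f (-s)) (-f' (-s)) s := by
      intro s hs
      have h1 := hf (-s) ⟨by linarith [hs.2], by linarith [hs.1]⟩
      simpa [Function.comp_def] using h1.scomp s (hasDerivAt_neg s)
    have := norm_le_gronwallBound_of_norm_deriv_right_le (f := fun s => f (-s))
      (f' := fun s => -f' (-s)) (δ := 0) (K := K)
      (ε := η) (a := 0) (b := T)
      (fun s hs => (hd s ⟨by linarith [hs.1, hs.2], hs.2⟩).continuousAt.continuousWithinAt)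
      (fun s hs => (hd s ⟨by linarith [hs.1, hs.2], hs.2.le⟩).hasDerivWithinAt)
      (by simp [h0]) (fun s hs => by
        rw [norm_neg]
        exact hb (-s) ⟨by linarith [hs.1, hs.2], by linarith [hs.1, hs.2]⟩) (-t)
        ⟨by linarith, by linarith [ht.1]⟩
    simpa [abs_of_nonpos h] using this

lemma aux_var (X : F → F) (hX : ContDiff ℝ 2 X) (Φ : ℝ → F → F)
    (hΦ0 : ∀ y, Φ 0 y = y)
    (hΦderiv : ∀ t y, HasDerivAt (fun s => Φ s y) (X (Φ t y)) t) (y : F) :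
    ∃ ε > 0, ∃ V : ℝ → (F →L[ℝ] F), V 0 = ContinuousLinearMap.id ℝ F ∧
      ∀ t ∈ Icc (-ε) ε, HasDerivAt V ((fderiv ℝ X (Φ t y)).comp (V t)) t := by
  have hX1 : ContDiff ℝ 1 X := hX.of_le (by norm_num)
  have hDX : ContDiff ℝ 1 (fderiv ℝ X) := hX.fderiv_right (by norm_num)
  let W : F × (F →L[ℝ] F) → F × (F →L[ℝ] F) := fun p => (X p.1, (fderiv ℝ X p.1).comp p.2)
  have hW : ContDiff ℝ 1 W :=
    (hX1.comp contDiff_fst).prodMk ((hDX.comp contDiff_fst).clm_comp contDiff_snd)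
  obtain ⟨α, hα0, ε, hε, hα⟩ :=
    ContDiffAt.exists_forall_mem_closedBall_exists_eq_forall_mem_Ioo_hasDerivAt₀
      (hW.contDiffAt (x := (y, ContinuousLinearMap.id ℝ F))) 0
  simp only [zero_sub, zero_add] at hα
  have hmem : ∀ t ∈ Icc (-(ε/2)) (ε/2), t ∈ Ioo (-ε) ε := fun t ht =>
    ⟨by linarith [ht.1], by linarith [ht.2]⟩
  have h1 : ∀ t ∈ Icc (-(ε/2)) (ε/2), HasDerivAt (fun s => (α s).1) (X (α t).1) t := by
    intro t ht
    exact (hasFDerivAt_fst (p := α t)).comp_hasDerivAt t (hα t (hmem t ht))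
  have h2 : ∀ t ∈ Icc (-(ε/2)) (ε/2),
      HasDerivAt (fun s => (α s).2) ((fderiv ℝ X (α t).1).comp (α t).2) t := by
    intro t ht
    exact (hasFDerivAt_snd (p := α t)).comp_hasDerivAt t (hα t (hmem t ht))
  refine ⟨ε/2, by linarith, fun s => (α s).2, by simp [hα0], fun t ht => ?_⟩
  have := aux_uniq X hX1 (t₀ := 0) (a := -(ε/2)) (b := ε/2) ⟨by linarith, by linarith⟩
    (fun s => (α s).1) (fun s => Φ s y)
    (fun s hs => (h1 s hs).continuousAt.continuousWithinAt)
    (fun s _ => (hΦderiv s y).continuousAt.continuousWithinAt)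
    (fun s hs => h1 s (Ioo_subset_Icc_self hs))
    (fun s _ => hΦderiv s y) (by simp [hα0, hΦ0]) ht
  have h3 := h2 t ht
  simp only at this
  rwa [this] at h3

lemma aux_fderiv (X : F → F) (hX : ContDiff ℝ 2 X) (Φ : ℝ → F → F)
    (hΦ0 : ∀ y, Φ 0 y = y)
    (hΦderiv : ∀ t y, HasDerivAt (fun s => Φ s y) (X (Φ t y)) t) (y : F) :
    ∃ V : ℝ → (F →L[ℝ] F), V 0 = 1 ∧ HasDerivAt V (fderiv ℝ X y) 0 ∧
      ∀ᶠ t in 𝓝 0, HasFDerivAt (Φ t) (V t) y := by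
  have hX1 : ContDiff ℝ 1 X := hX.of_le (by norm_num)
  have hDX : ContDiff ℝ 1 (fderiv ℝ X) := hX.fderiv_right (by norm_num)
  obtain ⟨ε₁, hε₁, V, hV0, hV⟩ := aux_var X hX Φ hΦ0 hΦderiv y
  obtain ⟨ε₂, hε₂, r, hr, L, hL⟩ := aux_flow_lip X hX1 Φ hΦ0 hΦderiv y
  refine ⟨V, hV0, by simpa [hV0, hΦ0] using hV 0 ⟨by linarith, hε₁.le⟩, ?_⟩
  have hc : ContinuousAt (fun s => Φ s y) 0 := (hΦderiv 0 y).continuousAt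
  obtain ⟨ε₃, hε₃, h3⟩ := Metric.continuousAt_iff.1 hc 1 one_pos
  simp only [hΦ0] at h3
  obtain ⟨T, hT, hT1, hT2, hT3⟩ : ∃ T > 0, T ≤ ε₁ ∧ T ≤ ε₂ ∧ T < ε₃ :=
    ⟨min (min ε₁ ε₂) (ε₃/2), by positivity, (min_le_left _ _).trans (min_le_left _ _),
      (min_le_left _ _).trans (min_le_right _ _), (min_le_right _ _).trans_lt (by linarith)⟩
  obtain ⟨M, hM⟩ := aux_lip (fderiv ℝ X) hDX y (1 + L * r)
  let K : ℝ := ‖fderiv ℝ X y‖ + M * 1 + 1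
  have hK : 0 < K := by positivity
  have hty : ∀ t ∈ Icc (-T) T, ‖Φ t y - y‖ ≤ 1 := by
    intro t ht
    rw [← dist_eq_norm]
    refine (h3 ?_).le
    rw [Real.dist_eq, sub_zero, abs_lt]
    exact ⟨by linarith [ht.1], by linarith [ht.2]⟩
  have hLr : 0 ≤ (L : ℝ) * r := by positivity
  have hA : ∀ t ∈ Icc (-T) T, ‖fderiv ℝ X (Φ t y)‖ ≤ K := by
    intro t ht
    have h1 : Φ t y ∈ closedBall y (1 + L * r) := by
      rw [mem_closedBall, dist_eq_norm]; linarith [hty t ht]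
    have h2 := hM.norm_sub_le h1 (mem_closedBall_self (by positivity))
    have h4 : (M : ℝ) * ‖Φ t y - y‖ ≤ M * 1 := by gcongr; exact hty t ht
    have h5 := norm_le_norm_sub_add (fderiv ℝ X (Φ t y)) (fderiv ℝ X y)
    simp only [K]; linarith
  filter_upwards [Icc_mem_nhds (show -T < (0:ℝ) by linarith) hT] with t ht
  have key : ∀ w ∈ closedBall y r, ‖Φ t w - Φ t y - V t (w - y)‖ ≤
      gronwallBound 0 K (M * L ^ 2 * ‖w - y‖ ^ 2) |t| := by
    intro w hw
    refine aux_gronwall (f := fun s => Φ s w - Φ s y - V s (w - y))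
      (f' := fun s => X (Φ s w) - X (Φ s y) - (fderiv ℝ X (Φ s y)) (V s (w - y)))
      (T := T) ?_ (by simp [hΦ0, hV0]) ?_ t ht
    · intro s hs
      have := (hV s ⟨by linarith [hs.1], by linarith [hs.2]⟩).clm_apply
        (hasDerivAt_const s (w - y))
      have h := ((hΦderiv s w).fun_sub (hΦderiv s y)).fun_sub this
      simpa using h
    · intro s hs
      have hd : ‖Φ s w - Φ s y‖ ≤ L * ‖w - y‖ :=
        (hL s ⟨by linarith [hs.1], by linarith [hs.2]⟩).norm_sub_le hw
          (mem_closedBall_self hr.le)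
      have hwr : ‖w - y‖ ≤ r := by rwa [← dist_eq_norm]
      have hLw : (L : ℝ) * ‖w - y‖ ≤ L * r := by gcongr
      have hR : ‖X (Φ s w) - X (Φ s y) - fderiv ℝ X (Φ s y) (Φ s w - Φ s y)‖
          ≤ (M * (L * ‖w - y‖)) * ‖Φ s w - Φ s y‖ := by
        have hsub : closedBall (Φ s y) (L * ‖w - y‖) ⊆ closedBall y (1 + L * r) := by
          apply closedBall_subset_closedBall'
          rw [dist_eq_norm]
          linarith [hty s hs]
        have hself : Φ s y ∈ closedBall (Φ s y) (L * ‖w - y‖) :=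
          mem_closedBall_self (by positivity)
        refine Convex.norm_image_sub_le_of_norm_fderiv_le' (𝕜 := ℝ)
          (s := closedBall (Φ s y) (L * ‖w - y‖))
          (fun x _ => hX1.differentiable one_ne_zero x) ?_ (convex_closedBall _ _) hself
          (by rwa [mem_closedBall, dist_eq_norm])
        intro x hx
        refine (hM.norm_sub_le (hsub hx) (hsub hself)).trans ?_
        rw [mem_closedBall, dist_eq_norm] at hx
        gcongr
      have e : X (Φ s w) - X (Φ s y) - (fderiv ℝ X (Φ s y)) (V s (w - y)) =
          fderiv ℝ X (Φ s y) (Φ s w - Φ s y - V s (w - y)) +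
          (X (Φ s w) - X (Φ s y) - fderiv ℝ X (Φ s y) (Φ s w - Φ s y)) := by
        rw [map_sub _ (Φ s w - Φ s y)]; abel
      rw [e]
      refine (norm_add_le _ _).trans (add_le_add ?_ (hR.trans ?_))
      · exact (ContinuousLinearMap.le_opNorm _ _).trans (by gcongr; exact hA s hs)
      · calc _ ≤ (M * (L * ‖w - y‖)) * (L * ‖w - y‖) := by gcongr
          _ = _ := by ring
  have hO : (fun w => Φ t w - Φ t y - V t (w - y)) =O[𝓝 y] fun w => ‖w - y‖ ^ 2 := by
    refine Asymptotics.IsBigO.of_bound (M * L ^ 2 / K * (Real.exp (K * |t|) - 1)) ?_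
    filter_upwards [closedBall_mem_nhds y hr] with w hw
    refine (key w hw).trans (le_of_eq ?_)
    rw [gronwallBound_of_K_ne_0 hK.ne', norm_pow, norm_norm]
    ring
  have h0 := hO.hasFDerivAt (𝕜 := ℝ) one_lt_two
  have hlin : HasFDerivAt (fun w => V t (w - y) + Φ t y) (V t) y := by
    have := (V t).hasFDerivAt.comp y ((hasFDerivAt_id (𝕜 := ℝ) y).sub_const y)
    simpa [Function.comp_def] using this.add_const (Φ t y)
  have := h0.add hlin
  rw [zero_add] at this
  convert! this using 1
  funext w
  simp only [Pi.add_apply]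
  abel

end helpers

/-- For C^∞ complete vector fields `X, Y` on `ℝ^N`, with `Φ` the flow of `X`, the curve
`t ↦ D(Φ_{−t})(Φ_t(y)) · Y(Φ_t(y))` (the pushforward of `Y` by `Φ_{−t}` evaluated at `y`)
is differentiable at `t = 0` with derivative `[X, Y](y)`. -/
theorem pushforward_deriv_eq_lieBracket
    {N : ℕ} (X Y : EuclideanSpace ℝ (Fin N) → EuclideanSpace ℝ (Fin N))
    (hX : ContDiff ℝ (⊤ : ℕ∞) X) (hY : ContDiff ℝ (⊤ : ℕ∞) Y)
    (Φ : ℝ → EuclideanSpace ℝ (Fin N) → EuclideanSpace ℝ (Fin N))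
    (hΦ0 : ∀ y, Φ 0 y = y)
    (hΦadd : ∀ s t y, Φ (s + t) y = Φ s (Φ t y))
    (hΦderiv : ∀ t y, HasDerivAt (fun s => Φ s y) (X (Φ t y)) t)
    (y : EuclideanSpace ℝ (Fin N)) :
    HasDerivAt (fun t => fderiv ℝ (fun z => Φ (-t) z) (Φ t y) (Y (Φ t y)))
      (lieBracket X Y y) 0 := by
  have hX2 : ContDiff ℝ 2 X := contDiff_infty.1 hX 2
  have hX1 : ContDiff ℝ 1 X := hX.of_le (by exact_mod_cast le_top)
  obtain ⟨V, hV0, hV, hVe⟩ := aux_fderiv X hX2 Φ hΦ0 hΦderiv y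
  obtain ⟨ε, hε, r, hr, L, hL⟩ := aux_flow_lip X hX1 Φ hΦ0 hΦderiv y
  have hInv : HasDerivAt (fun t => Ring.inverse (V t)) (-fderiv ℝ X y) 0 := by
    have h1 := hasFDerivAt_ringInverse (𝕜 := ℝ)
      (1 : (EuclideanSpace ℝ (Fin N) →L[ℝ] EuclideanSpace ℝ (Fin N))ˣ)
    have h2 := HasFDerivAt.comp_hasDerivAt_of_eq (0 : ℝ) h1 hV (by simp [hV0])
    simpa [Function.comp_def] using h2
  have hYd : HasDerivAt (fun t => Y (Φ t y)) (fderiv ℝ Y y (X y)) 0 := by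
    have h1 : HasFDerivAt Y (fderiv ℝ Y y) y :=
      (hY.differentiable (by simp) y).hasFDerivAt
    have h2 := HasFDerivAt.comp_hasDerivAt_of_eq (0 : ℝ) h1 (hΦderiv 0 y) (by simp [hΦ0])
    simpa [Function.comp_def, hΦ0] using h2
  have hmain := hInv.clm_apply hYd
  have hunit : ∀ᶠ t in nhds (0 : ℝ), IsUnit (V t) := by
    have : IsUnit (V 0) := by rw [hV0]; exact isUnit_one
    exact hV.continuousAt.eventually (Units.isOpen.mem_nhds this)
  have hball : ∀ᶠ t in nhds (0 : ℝ), Φ t y ∈ Metric.ball y r :=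
    (hΦderiv 0 y).continuousAt.eventually
      (by simp only [hΦ0]; exact Metric.ball_mem_nhds y hr)
  have heq : ∀ᶠ t in nhds (0 : ℝ),
      fderiv ℝ (fun z => Φ (-t) z) (Φ t y) (Y (Φ t y)) = Ring.inverse (V t) (Y (Φ t y)) := by
    filter_upwards [hunit, hball, hVe, Icc_mem_nhds (show -ε < (0:ℝ) by linarith) hε]
      with t hu hb hd ht
    obtain ⟨u, hu⟩ := hu
    have hcont : ContinuousAt (Φ (-t)) (Φ t y) :=
      (hL (-t) ⟨by linarith [ht.2], by linarith [ht.1]⟩).continuousOn.continuousAt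
        (Filter.mem_of_superset (Metric.isOpen_ball.mem_nhds hb) Metric.ball_subset_closedBall)
    have hback : Φ (-t) (Φ t y) = y := by rw [← hΦadd]; simp [hΦ0]
    have hd' : HasFDerivAt (Φ t) ((ContinuousLinearEquiv.ofUnit u : _ →L[ℝ] _))
        (Φ (-t) (Φ t y)) := by
      rw [hback]
      convert! hd using 1
    have h3 := HasFDerivAt.of_local_left_inverse hcont hd'
      (Filter.Eventually.of_forall fun z => by rw [← hΦadd]; simp [hΦ0])
    have h4 : fderiv ℝ (fun z => Φ (-t) z) (Φ t y) = _ := h3.fderiv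
    rw [h4, ← hu, Ring.inverse_unit]
    rfl
  refine (hmain.congr_of_eventuallyEq heq).congr_deriv ?_
  simp [lieBracket, hΦ0, hV0, sub_eq_add_neg, add_comm]
end
end
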